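/- arXiv:2201.09835 — 2 statements merged into one kernel-verified Lean document; each statement's English description precedes it below -/
import Mathlib

section
/- Let G = ([n],E) be a 2-connected graph such that every edge of G is contained in some 3-cycle or 4-cycle of G, and every vertex of G has degree at least 3. Then for every edge e ∈ E there exists a total order < on E, with <' its restriction to E∖{e}, such that γ₂(G,<) ≥ γ₂(G∖e,<'). -/
open SimpleGraph Finset Filter

namespace SEP

/-- The vector `e_i - e_j` in `ℝ^n`. -/
def eVec {n : ℕ} (i j : Fin n) : Fin n → ℝ :=
  fun t => (if t = i then 1 else 0) - (if t = j then 1 else 0)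

/-- The symmetric edge polytope of a graph on `Fin n`. -/
def symEdgePolytope {n : ℕ} (G : SimpleGraph (Fin n)) : Set (Fin n → ℝ) :=
  convexHull ℝ {x | ∃ i j, G.Adj i j ∧ x = eVec i j}

/-- Both darts `a` and `b` are arcs of a common directed cycle of length `m` of `G`. -/
def dartsInCycle {V : Type*} (G : SimpleGraph V) (a b : G.Dart) (m : ℕ) : Prop :=
  ∃ (u : V) (w : G.Walk u u), w.IsCycle ∧ w.length = m ∧ a ∈ w.darts ∧ b ∈ w.darts

/-- `F` is a face of the polytope `P`: the set of maximizers of some linear functional. -/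
def IsFaceOfPolytope {n : ℕ} (P F : Set (Fin n → ℝ)) : Prop :=
  ∃ a : Fin n → ℝ,
    F = {x | x ∈ P ∧ ∀ y ∈ P, ∑ t, a t * y t ≤ ∑ t, a t * x t}

/-- Dimension of (the affine span of) a subset of `ℝ^n`. -/
noncomputable def polyDim {n : ℕ} (s : Set (Fin n → ℝ)) : ℕ :=
  Module.finrank ℝ (vectorSpan ℝ s)

/-- `v` is a vertex of the polytope `P`. -/
def IsVertexOfPolytope {n : ℕ} (P : Set (Fin n → ℝ)) (v : Fin n → ℝ) : Prop :=
  IsFaceOfPolytope P {v}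

/-- `F` is an edge (a 1-dimensional face) of the polytope `P`. -/
def IsEdgeOfPolytope {n : ℕ} (P F : Set (Fin n → ℝ)) : Prop :=
  IsFaceOfPolytope P F ∧ polyDim F = 1

/-- A polytope is simple if every vertex lies on exactly `dim P` edges. -/
def IsSimplePolytope {n : ℕ} (P : Set (Fin n → ℝ)) : Prop :=
  ∀ v, IsVertexOfPolytope P v →
    Set.ncard {F : Set (Fin n → ℝ) | IsEdgeOfPolytope P F ∧ v ∈ F} = polyDim P

/-- Two disjoint edges, on four vertices. -/
def twoDisjointEdges : SimpleGraph (Fin 4) :=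
  SimpleGraph.fromEdgeSet {s(0, 1), s(2, 3)}

/-- The cyclomatic number `|E| - |V| + c` of a graph, as an integer. -/
noncomputable def cyc {V : Type*} (G : SimpleGraph V) : ℤ :=
  (G.edgeSet.ncard : ℤ) + Nat.card G.ConnectedComponent - Nat.card V

/-- A graph is 2-connected: connected, with at least 3 vertices, and deleting any
single vertex leaves it connected. -/
def TwoConnected {V : Type*} (G : SimpleGraph V) : Prop :=
  G.Connected ∧ 3 ≤ Nat.card V ∧ ∀ v : V, (G.induce {u | u ≠ v}).Connected

/-- The subgraph `H` consists of a single edge of `G`. -/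
def IsSingleEdge {V : Type*} (G : SimpleGraph V) (H : G.Subgraph) : Prop :=
  ∃ (u v : V) (h : G.Adj u v), H = G.subgraphOfAdj h

/-- `H` is a 2-connected component (block) of `G`: an inclusion-maximal subgraph that is
2-connected or a single edge. -/
def IsBlock {V : Type*} (G : SimpleGraph V) (H : G.Subgraph) : Prop :=
  (TwoConnected H.coe ∨ IsSingleEdge G H) ∧
    ∀ H' : G.Subgraph, H ≤ H' → (TwoConnected H'.coe ∨ IsSingleEdge G H') → H' = H

/-- A pair of darts (oriented edges) of `G`, with distinct underlying edges, is *bad*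
with respect to the order `elt` on edges. -/
def BadPair {V : Type*} (G : SimpleGraph V) (elt : Sym2 V → Sym2 V → Prop)
    (a b : G.Dart) : Prop :=
  a.edge ≠ b.edge ∧
    (dartsInCycle G a b 3 ∨
      ∃ (u : V) (w : G.Walk u u), w.IsCycle ∧ w.length = 4 ∧ a ∈ w.darts ∧ b ∈ w.darts ∧
        (∃ e ∈ w.edges, elt e a.edge) ∧ (∃ e ∈ w.edges, elt e b.edge))

/-- `n₁(G, <)`: the number of (unordered) bad pairs of oriented edges. -/
noncomputable def n1 {V : Type*} (G : SimpleGraph V) (elt : Sym2 V → Sym2 V → Prop) : ℕ :=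
  Set.ncard {z : Sym2 G.Dart | ∃ a b, BadPair G elt a b ∧ z = s(a, b)}

/-- `γ₂(G, <) = 2 cy(G)(cy(G)+2) - n₁(G, <)`. -/
noncomputable def gammaTwo {V : Type*} (G : SimpleGraph V)
    (elt : Sym2 V → Sym2 V → Prop) : ℤ :=
  2 * cyc G * (cyc G + 2) - (n1 G elt : ℤ)

/-- Restriction of an order on `Sym2 V` to `Sym2 s` for `s : Set V`. -/
def restrictOrd {V : Type*} (elt : Sym2 V → Sym2 V → Prop) (s : Set V) :
    Sym2 s → Sym2 s → Prop :=
  fun e₁ e₂ => elt (e₁.map Subtype.val) (e₂.map Subtype.val)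

/-- The graph `G_n` on `Fin n`: vertices `0` and `1` are adjacent to everything. -/
def GnGraph (n : ℕ) : SimpleGraph (Fin n) :=
  SimpleGraph.fromRel (fun a _ => a.val < 2)

/-- The complete bipartite graph `K_{2, n-2}` on `Fin n`, with parts `{0,1}` and the rest. -/
def K2Graph (n : ℕ) : SimpleGraph (Fin n) :=
  SimpleGraph.fromRel (fun a b => a.val < 2 ∧ 2 ≤ b.val)

/-- A set `S` of darts of `G` is a face of the triangulation `Δ_<` of `∂P_G`. -/
def IsFace {V : Type*} (G : SimpleGraph V) (elt : Sym2 V → Sym2 V → Prop)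
    (S : Set G.Dart) : Prop :=
  (¬ ∃ d ∈ S, d.symm ∈ S) ∧
    ∀ ℓ : ℕ, 2 ≤ ℓ → ∀ (u : V) (w : G.Walk u u), w.IsCycle →
      (w.length = 2 * ℓ - 1 → Set.ncard {d ∈ S | d ∈ w.darts} < ℓ) ∧
      (w.length = 2 * ℓ →
        Set.ncard {d ∈ S | d ∈ w.darts ∧ ∃ e ∈ w.edges, elt e d.edge} < ℓ)

/-- The face complex `Δ_<` of `(G, <)`. -/
def faceCx {V : Type*} (G : SimpleGraph V) (elt : Sym2 V → Sym2 V → Prop) :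
    Set (Set G.Dart) :=
  {S | IsFace G elt S}

/-- The join of two simplicial complexes (given as families of faces on disjoint
vertex types). -/
def joinCx {A B : Type*} (F : Set (Set A)) (H : Set (Set B)) : Set (Set (A ⊕ B)) :=
  {S | ∃ F₁ ∈ F, ∃ H₁ ∈ H, S = Sum.inl '' F₁ ∪ Sum.inr '' H₁}

/-- The complex consisting of two disjoint vertices. -/
def twoPtCx : Set (Set (Fin 2)) :=
  {S | S = ∅ ∨ S = {0} ∨ S = {1}}

/-- Contraction of the edge `{v, w}` of a simplicial complex; `v` is identified with `w`. -/
def contractCx {A : Type*} (F : Set (Set A)) (v w : A) : Set (Set A) :=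
  {S | (S ∈ F ∧ v ∉ S) ∨ ∃ H ∈ F, v ∈ H ∧ S = (H \ {v}) ∪ {w}}

/-- Isomorphism of simplicial complexes: a bijection of vertex sets inducing a bijection
of faces. -/
def CxIso {A B : Type*} (F : Set (Set A)) (H : Set (Set B)) : Prop :=
  ∃ φ : A → B, Set.BijOn φ (⋃₀ F) (⋃₀ H) ∧
    (∀ S ∈ F, φ '' S ∈ H) ∧ (∀ T ∈ H, ∃ S ∈ F, φ '' S = T)

/-! ### Erdős–Rényi random graphs -/

/-- The probability weight of a fixed graph `G` in the Erdős–Rényi model `G(n,p)`. -/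
noncomputable def graphWeight (n : ℕ) (p : ℝ) (G : SimpleGraph (Fin n)) : ℝ :=
  p ^ G.edgeSet.ncard * (1 - p) ^ (n.choose 2 - G.edgeSet.ncard)

/-- The probability of an event `A` in the Erdős–Rényi model `G(n,p)`. -/
noncomputable def erProb (n : ℕ) (p : ℝ) (A : Set (SimpleGraph (Fin n))) : ℝ :=
  ∑ G : SimpleGraph (Fin n), A.indicator (graphWeight n p) G

/-- The expectation of a random variable in the Erdős–Rényi model `G(n,p)`. -/
noncomputable def erExp (n : ℕ) (p : ℝ) (X : SimpleGraph (Fin n) → ℝ) : ℝ :=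
  ∑ G : SimpleGraph (Fin n), graphWeight n p G * X G

/-- The variance of a random variable in the Erdős–Rényi model `G(n,p)`. -/
noncomputable def erVar (n : ℕ) (p : ℝ) (X : SimpleGraph (Fin n) → ℝ) : ℝ :=
  erExp n p (fun G => (X G - erExp n p X) ^ 2)

/-- The number of cycles of `G` with exactly `k` vertices, counted via their edge sets. -/
noncomputable def numCycles {V : Type*} (G : SimpleGraph V) (k : ℕ) : ℕ :=
  Set.ncard {s : Set (Sym2 V) |
    ∃ (u : V) (w : G.Walk u u), w.IsCycle ∧ w.length = k ∧ s = {e | e ∈ w.edges}}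

/-- `E(X_k) = C(n,k)·((k−1)!/2)·p^k`, the expected number of `k`-cycles. -/
noncomputable def expCycles (n : ℕ) (p : ℝ) (k : ℕ) : ℝ :=
  (n.choose k : ℝ) * ((Nat.factorial (k - 1) : ℝ) / 2) * p ^ k

/-- `E(X_E) = C(n,2)·p`, the expected number of edges. -/
noncomputable def expEdges (n : ℕ) (p : ℝ) : ℝ :=
  (n.choose 2 : ℝ) * p

/-- `n_{k-1}(G)`: the number of `k`-element non-faces of `Δ_<` containing no antipodal
pair. -/
noncomputable def numNonFaces {V : Type*} (G : SimpleGraph V)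
    (elt : Sym2 V → Sym2 V → Prop) (k : ℕ) : ℕ :=
  Set.ncard {S : Set G.Dart |
    S.ncard = k ∧ (¬ ∃ d ∈ S, d.symm ∈ S) ∧ ¬ IsFace G elt S}

/-- `f_{k-1}(G)`: the number of `k`-element faces of `Δ_<`. -/
noncomputable def numFaces {V : Type*} (G : SimpleGraph V)
    (elt : Sym2 V → Sym2 V → Prop) (k : ℕ) : ℕ :=
  Set.ncard {S : Set G.Dart | S.ncard = k ∧ IsFace G elt S}

/-- The generalized binomial coefficient `binom(x, ℓ)` for real `x`. -/
noncomputable def realChoose (x : ℝ) (ℓ : ℕ) : ℝ :=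
  (∏ i ∈ Finset.range ℓ, (x - i)) / (Nat.factorial ℓ)

/-- The recursively defined γ-numbers `γ_ℓ(G)`:
`γ_0 = 1` and
`γ_ℓ = f_{ℓ−1} − [t^{n−1−ℓ}] ∑_{i<ℓ} γ_i (t+1)^i (t+2)^{n−1−2i}`. -/
noncomputable def gammaRG (n : ℕ) (G : SimpleGraph (Fin n))
    (elt : Sym2 (Fin n) → Sym2 (Fin n) → Prop) : ℕ → ℤ := fun ℓ =>
  Nat.strongRecOn ℓ (fun ℓ ih =>
    if ℓ = 0 then (1 : ℤ)
    else
      (numFaces G elt ℓ : ℤ) -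
        Polynomial.coeff
          (∑ i ∈ (Finset.range ℓ).attach,
            Polynomial.C (ih i.1 (Finset.mem_range.mp i.2)) *
              ((Polynomial.X + 1) ^ (i.1 : ℕ) *
                (Polynomial.X + 2) ^ (n - 1 - 2 * i.1) : Polynomial ℤ))
          (n - 1 - ℓ))

/-- The edges of the complete graph ranked so that `s(u, v)` comes first, then the other edges
meeting `{u, v}`, ordered by their other endpoint, then all remaining edges. -/
def edgeRank {n : ℕ} (u v : Fin n) (z : Sym2 (Fin n)) : ℕ :=
  if u ∈ z ∨ v ∈ z then ∑ c : Fin n with c ∈ z ∧ c ≠ u ∧ c ≠ v, (c.val + 1) else n + 1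

/-- A total order on edges refining `edgeRank u v`. -/
def edgeOrder {n : ℕ} (u v : Fin n) (y z : Sym2 (Fin n)) : Prop :=
  toLex (edgeRank u v y, Fintype.equivFin (Sym2 (Fin n)) y) <
    toLex (edgeRank u v z, Fintype.equivFin (Sym2 (Fin n)) z)

theorem edgeOrder_comm {n : ℕ} (u v : Fin n) : edgeOrder u v = edgeOrder v u := by
  have : edgeRank u v = edgeRank v u := by
    funext z
    simp only [edgeRank, or_comm (a := u ∈ z), and_comm (a := _ ≠ u)]
  unfold edgeOrder
  rw [this]

theorem edgeOrder_isStrictTotalOrder {n : ℕ} (u v : Fin n) :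
    IsStrictTotalOrder (Sym2 (Fin n)) (edgeOrder u v) :=
  let f : Sym2 (Fin n) → ℕ ×ₗ Fin _ :=
    fun z => toLex (edgeRank u v z, Fintype.equivFin (Sym2 (Fin n)) z)
  have hf : f.Injective := fun y z h => by
    have := congrArg (fun p => (ofLex p).2) h
    exact (Fintype.equivFin _).injective this
  (RelEmbedding.preimage ⟨f, hf⟩ (· < ·)).isStrictTotalOrder

theorem edgeOrder_of_rank_lt {n : ℕ} {u v : Fin n} {y z : Sym2 (Fin n)}
    (h : edgeRank u v y < edgeRank u v z) : edgeOrder u v y z :=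
  Prod.Lex.toLex_lt_toLex.2 (Or.inl h)

theorem edgeRank_le_of_order {n : ℕ} {u v : Fin n} {y z : Sym2 (Fin n)}
    (h : edgeOrder u v y z) : edgeRank u v y ≤ edgeRank u v z := by
  rcases Prod.Lex.toLex_lt_toLex.1 h with h | h
  · exact h.le
  · exact h.1.le

theorem edgeRank_self {n : ℕ} (u v : Fin n) : edgeRank u v s(u, v) = 0 := by
  simp only [edgeRank, Sym2.mem_iff, true_or, if_true]
  refine Finset.sum_eq_zero fun c hc => ?_
  grind

theorem edgeRank_star {n : ℕ} {u v x c : Fin n} (hx : x = u ∨ x = v) (hu : c ≠ u)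
    (hv : c ≠ v) : edgeRank u v s(x, c) = c + 1 := by
  have : ({d : Fin n | d ∈ s(x, c) ∧ d ≠ u ∧ d ≠ v} : Finset (Fin n)) = {c} := by
    ext d
    simp only [Finset.mem_filter, Finset.mem_univ, Sym2.mem_iff, Finset.mem_singleton]
    grind
  rw [edgeRank, if_pos (by simp only [Sym2.mem_iff]; grind), this, Finset.sum_singleton]

theorem edgeRank_away {n : ℕ} {u v b c : Fin n} (hbu : b ≠ u) (hbv : b ≠ v) (hcu : c ≠ u)
    (hcv : c ≠ v) : edgeRank u v s(b, c) = n + 1 := by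
  rw [edgeRank, if_neg (by simp only [Sym2.mem_iff]; grind)]

theorem not_edgeOrder_self {n : ℕ} {u v b c : Fin n} (hbc : b ≠ c) :
    ¬ edgeOrder u v s(b, c) s(u, v) := by
  intro h
  have hle := edgeRank_le_of_order h
  rw [edgeRank_self] at hle
  by_cases hb : b = u ∨ b = v
  · by_cases hc : c = u ∨ c = v
    · have : s(b, c) = s(u, v) := by rw [Sym2.eq_iff]; grind
      rw [this] at h
      exact lt_irrefl _ h
    · rw [edgeRank_star hb (by grind) (by grind)] at hle
      omega
  · by_cases hc : c = u ∨ c = v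
    · rw [Sym2.eq_swap, edgeRank_star hc (by grind) (by grind)] at hle
      omega
    · rw [edgeRank_away (by grind) (by grind) (by grind) (by grind)] at hle
      omega

/-- Vertices `p, q, r, s` form a 4-cycle of `G` in this cyclic order. -/
def IsQuad {V : Type*} (G : SimpleGraph V) (p q r s : V) : Prop :=
  G.Adj p q ∧ G.Adj q r ∧ G.Adj r s ∧ G.Adj s p ∧ p ≠ r ∧ q ≠ s

/-- Some edge of the closed walk `p q r s` precedes `f`. -/
def QuadBelow {V : Type*} (elt : Sym2 V → Sym2 V → Prop) (p q r s : V) (f : Sym2 V) : Prop :=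
  elt s(p, q) f ∨ elt s(q, r) f ∨ elt s(r, s) f ∨ elt s(s, p) f

/-- The bad pairs of `G`, seen as unordered pairs of ordered pairs of vertices. -/
def badPairs {V : Type*} (G : SimpleGraph V) (elt : Sym2 V → Sym2 V → Prop) :
    Set (Sym2 (V × V)) :=
  {z | ∃ a b : G.Dart, BadPair G elt a b ∧ z = s(a.toProd, b.toProd)}

theorem n1_eq_ncard_badPairs {V : Type*} (G : SimpleGraph V)
    (elt : Sym2 V → Sym2 V → Prop) : n1 G elt = (badPairs G elt).ncard := by
  have hinj : Function.Injective (Sym2.map (SimpleGraph.Dart.toProd (G := G))) :=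
    Sym2.map.injective SimpleGraph.Dart.toProd_injective
  rw [n1, ← Set.ncard_image_of_injective _ hinj]
  congr 1
  ext z
  simp only [badPairs, Set.mem_image, Set.mem_ofPred_eq]
  constructor
  · rintro ⟨_, ⟨a, b, h, rfl⟩, rfl⟩
    exact ⟨a, b, h, rfl⟩
  · rintro ⟨a, b, h, rfl⟩
    exact ⟨_, ⟨a, b, h, rfl⟩, rfl⟩

section

variable {V : Type*} {G : SimpleGraph V} {elt : Sym2 V → Sym2 V → Prop}

theorem IsQuad.rotate {p q r s : V} (h : IsQuad G p q r s) : IsQuad G q r s p :=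
  ⟨h.2.1, h.2.2.1, h.2.2.2.1, h.1, h.2.2.2.2.2, h.2.2.2.2.1.symm⟩

theorem IsQuad.reverse {p q r s : V} (h : IsQuad G p q r s) : IsQuad G r q p s :=
  ⟨h.2.1.symm, h.1.symm, h.2.2.2.1.symm, h.2.2.1.symm, h.2.2.2.2.1.symm, h.2.2.2.2.2⟩

theorem QuadBelow.rotate {p q r s : V} {f : Sym2 V} (h : QuadBelow elt p q r s f) :
    QuadBelow elt q r s p f := by
  unfold QuadBelow at *
  grind

theorem exists_triangle_of_isCycle {u : V} (w : G.Walk u u) (hl : w.length = 3) :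
    ∃ x y z, G.Adj x y ∧ G.Adj y z ∧ G.Adj z x ∧
      w.darts.map SimpleGraph.Dart.toProd = [(x, y), (y, z), (z, x)] := by
  match w, hl with
  | .cons (v := b) h₁ (.cons (v := c) h₂ (.cons h₃ .nil)), _ =>
    exact ⟨u, b, c, h₁, h₂, h₃, rfl⟩

theorem exists_quad_of_isCycle {u : V} (w : G.Walk u u) (hw : w.IsCycle)
    (hl : w.length = 4) :
    ∃ p q r s, IsQuad G p q r s ∧
      w.darts.map SimpleGraph.Dart.toProd = [(p, q), (q, r), (r, s), (s, p)] ∧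
      w.edges = [s(p, q), s(q, r), s(r, s), s(s, p)] := by
  match w, hw, hl with
  | .cons (v := b) h₁ (.cons (v := c) h₂ (.cons (v := d) h₃ (.cons h₄ .nil))), hw, _ =>
    have := hw.support_nodup
    refine ⟨u, b, c, d, ⟨h₁, h₂, h₃, h₄, ?_, ?_⟩, rfl, rfl⟩ <;> simp at this <;> grind

theorem mem_badPairs_of_triangle {x y z : V} (hxy : G.Adj x y) (hyz : G.Adj y z)
    (hzx : G.Adj z x) : s((x, y), (y, z)) ∈ badPairs G elt := by
  have h₁ := hxy.ne
  have h₂ := hyz.ne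
  have h₃ := hzx.ne
  refine ⟨⟨(x, y), hxy⟩, ⟨(y, z), hyz⟩, ⟨?_, Or.inl
    ⟨x, .cons hxy (.cons hyz (.cons hzx .nil)), ?_, rfl, by simp, by simp⟩⟩, rfl⟩
  · simp only [SimpleGraph.Dart.edge_mk, ne_eq, Sym2.eq_iff]
    grind
  · simp [SimpleGraph.Walk.isCycle_def, SimpleGraph.Walk.isTrail_def]
    grind

theorem IsQuad.isCycle {p q r s : V} (h : IsQuad G p q r s) :
    (SimpleGraph.Walk.cons h.1 (.cons h.2.1 (.cons h.2.2.1
      (.cons h.2.2.2.1 .nil)))).IsCycle := by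
  obtain ⟨h₁, h₂, h₃, h₄, h₅, h₆⟩ := h
  have := h₁.ne
  have := h₂.ne
  have := h₃.ne
  have := h₄.ne
  simp [SimpleGraph.Walk.isCycle_def, SimpleGraph.Walk.isTrail_def]
  grind

theorem IsQuad.mem_badPairs_adjacent {p q r s : V} (h : IsQuad G p q r s)
    (h₁ : QuadBelow elt p q r s s(p, q)) (h₂ : QuadBelow elt p q r s s(q, r)) :
    s((p, q), (q, r)) ∈ badPairs G elt := by
  refine ⟨⟨(p, q), h.1⟩, ⟨(q, r), h.2.1⟩, ⟨?_, Or.inr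
    ⟨p, _, h.isCycle, rfl, by simp, by simp, ?_, ?_⟩⟩, rfl⟩
  · simp only [SimpleGraph.Dart.edge_mk, ne_eq, Sym2.eq_iff]
    have := h.1.ne
    have := h.2.2.2.2.1
    grind
  · simpa [QuadBelow] using h₁
  · simpa [QuadBelow] using h₂

theorem IsQuad.mem_badPairs_opposite {p q r s : V} (h : IsQuad G p q r s)
    (h₁ : QuadBelow elt p q r s s(p, q)) (h₂ : QuadBelow elt p q r s s(r, s)) :
    s((p, q), (r, s)) ∈ badPairs G elt := by
  refine ⟨⟨(p, q), h.1⟩, ⟨(r, s), h.2.2.1⟩, ⟨?_, Or.inr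
    ⟨p, _, h.isCycle, rfl, by simp, by simp, ?_, ?_⟩⟩, rfl⟩
  · simp only [SimpleGraph.Dart.edge_mk, ne_eq, Sym2.eq_iff]
    have := h.2.2.2.1.ne
    have := h.2.2.2.2.1
    grind
  · simpa [QuadBelow] using h₁
  · simpa [QuadBelow] using h₂

theorem exists_cycle_of_mem_badPairs {z : Sym2 (V × V)} (hz : z ∈ badPairs G elt) :
    (∃ a b c, G.Adj a b ∧ G.Adj b c ∧ G.Adj c a ∧ z = s((a, b), (b, c))) ∨
      ∃ p q r s, IsQuad G p q r s ∧ QuadBelow elt p q r s s(p, q) ∧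
        ((QuadBelow elt p q r s s(q, r) ∧ z = s((p, q), (q, r))) ∨
          (QuadBelow elt p q r s s(r, s) ∧ z = s((p, q), (r, s)))) := by
  obtain ⟨⟨a, ha'⟩, ⟨b, hb'⟩, ⟨hne, h⟩, rfl⟩ := hz
  have hab : a ≠ b := by rintro rfl; exact hne rfl
  rcases h with ⟨u, w, -, hl, ha, hb⟩ | ⟨u, w, hw, hl, ha, hb, hea, heb⟩
  · left
    obtain ⟨x, y, z, h₁, h₂, h₃, hd⟩ := exists_triangle_of_isCycle w hl
    have ha := List.mem_map_of_mem (f := SimpleGraph.Dart.toProd) ha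
    have hb := List.mem_map_of_mem (f := SimpleGraph.Dart.toProd) hb
    simp only [hd, List.mem_cons, List.not_mem_nil, or_false] at ha hb
    have key : ∃ a' b' c', G.Adj a' b' ∧ G.Adj b' c' ∧ G.Adj c' a' ∧
        ((a = (a', b') ∧ b = (b', c')) ∨ (b = (a', b') ∧ a = (b', c'))) := by
      rcases ha with rfl | rfl | rfl <;> rcases hb with rfl | rfl | rfl
      · exact absurd rfl hab
      · exact ⟨x, y, z, h₁, h₂, h₃, Or.inl ⟨rfl, rfl⟩⟩
      · exact ⟨z, x, y, h₃, h₁, h₂, Or.inr ⟨rfl, rfl⟩⟩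
      · exact ⟨x, y, z, h₁, h₂, h₃, Or.inr ⟨rfl, rfl⟩⟩
      · exact absurd rfl hab
      · exact ⟨y, z, x, h₂, h₃, h₁, Or.inl ⟨rfl, rfl⟩⟩
      · exact ⟨z, x, y, h₃, h₁, h₂, Or.inl ⟨rfl, rfl⟩⟩
      · exact ⟨y, z, x, h₂, h₃, h₁, Or.inr ⟨rfl, rfl⟩⟩
      · exact absurd rfl hab
    obtain ⟨a', b', c', k₁, k₂, k₃, ⟨rfl, rfl⟩ | ⟨rfl, rfl⟩⟩ := key
    · exact ⟨a', b', c', k₁, k₂, k₃, rfl⟩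
    · exact ⟨a', b', c', k₁, k₂, k₃, Sym2.eq_swap⟩
  · right
    obtain ⟨p, q, r, s, hQ, hd, he⟩ := exists_quad_of_isCycle w hw hl
    have ha := List.mem_map_of_mem (f := SimpleGraph.Dart.toProd) ha
    have hb := List.mem_map_of_mem (f := SimpleGraph.Dart.toProd) hb
    simp only [hd, List.mem_cons, List.not_mem_nil, or_false] at ha hb
    simp only [he, List.mem_cons, List.not_mem_nil, or_false, exists_eq_or_imp,
      exists_eq_left] at hea heb
    simp only [SimpleGraph.Dart.edge_mk] at hea heb
    obtain ⟨p, q, r, s, hQ, rfl, hb, hea, heb⟩ : ∃ p q r s, IsQuad G p q r s ∧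
        a = (p, q) ∧ (b = (q, r) ∨ b = (r, s) ∨ b = (s, p)) ∧
        QuadBelow elt p q r s s(a.1, a.2) ∧ QuadBelow elt p q r s s(b.1, b.2) := by
      have hea : QuadBelow elt p q r s s(a.1, a.2) := hea
      have heb : QuadBelow elt p q r s s(b.1, b.2) := heb
      rcases ha with ha | ha | ha | ha
      · exact ⟨p, q, r, s, hQ, ha, by grind, hea, heb⟩
      · exact ⟨q, r, s, p, hQ.rotate, ha, by grind, hea.rotate, heb.rotate⟩
      · exact ⟨r, s, p, q, hQ.rotate.rotate, ha, by grind, hea.rotate.rotate, heb.rotate.rotate⟩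
      · exact ⟨s, p, q, r, hQ.rotate.rotate.rotate, ha, by grind, hea.rotate.rotate.rotate,
          heb.rotate.rotate.rotate⟩
    rcases hb with rfl | rfl | rfl
    · exact ⟨p, q, r, s, hQ, hea, Or.inl ⟨heb, rfl⟩⟩
    · exact ⟨p, q, r, s, hQ, hea, Or.inr ⟨heb, rfl⟩⟩
    · exact ⟨s, p, q, r, hQ.rotate.rotate.rotate, heb.rotate.rotate.rotate,
        Or.inl ⟨hea.rotate.rotate.rotate, Sym2.eq_swap⟩⟩

end

/-- Common neighbours of `x` and `y`. -/
noncomputable def commonNbrs {n : ℕ} (G : SimpleGraph (Fin n)) (x y : Fin n) :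
    Finset (Fin n) :=
  open Classical in {c | G.Adj x c ∧ G.Adj y c}

/-- Pairs `(a, b)` such that `x, a, b, y` is a path closed by the edge from `y` to `x`. -/
noncomputable def quadPairs {n : ℕ} (G : SimpleGraph (Fin n)) (x y : Fin n) :
    Finset (Fin n × Fin n) :=
  open Classical in
  {d | (G.Adj x d.1 ∧ d.1 ≠ y) ∧ (G.Adj y d.2 ∧ d.2 ≠ x) ∧ G.Adj d.1 d.2}

/-- The pairs `(a, b)` of `quadPairs G x y` such that `b` is not adjacent to `x`, and `a` is
the smallest vertex that can precede `b`. -/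
noncomputable def firstQuadPairs {n : ℕ} (G : SimpleGraph (Fin n)) (x y : Fin n) :
    Finset (Fin n × Fin n) :=
  open Classical in
  {d ∈ quadPairs G x y | ¬ G.Adj x d.2 ∧ ∀ a, (a, d.2) ∈ quadPairs G x y → d.1 ≤ a}

/-- Bad pairs that may be destroyed by deleting the edge `s(x, y)`, up to exchanging `x`
and `y`. -/
noncomputable def newPairs {n : ℕ} (G : SimpleGraph (Fin n)) (x y : Fin n) :
    Finset (Sym2 (Fin n × Fin n)) :=
  (commonNbrs G x y).image (fun c => s((x, y), (y, c))) ∪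
  (commonNbrs G x y).image (fun c => s((c, x), (x, y))) ∪
  {c ∈ commonNbrs G x y | ∀ d ∈ commonNbrs G x y, c ≤ d}.image (fun c => s((x, c), (c, y))) ∪
  (quadPairs G x y).image (fun d => s((x, d.1), (d.2, y))) ∪
  (firstQuadPairs G x y).image (fun d => s((x, d.1), (d.1, d.2))) ∪
  (firstQuadPairs G x y).image (fun d => s((d.2, d.1), (d.1, x)))

section

variable {n : ℕ} {G : SimpleGraph (Fin n)} {x y : Fin n}

theorem mem_commonNbrs {c : Fin n} : c ∈ commonNbrs G x y ↔ G.Adj x c ∧ G.Adj y c := by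
  simp [commonNbrs]

theorem mem_quadPairs {a b : Fin n} : (a, b) ∈ quadPairs G x y ↔
    (G.Adj x a ∧ a ≠ y) ∧ (G.Adj y b ∧ b ≠ x) ∧ G.Adj a b := by
  simp [quadPairs]

theorem mem_firstQuadPairs {a b : Fin n} : (a, b) ∈ firstQuadPairs G x y ↔
    (a, b) ∈ quadPairs G x y ∧ ¬ G.Adj x b ∧ ∀ a', (a', b) ∈ quadPairs G x y → a ≤ a' := by
  simp [firstQuadPairs]

theorem mem_newPairs {z : Sym2 (Fin n × Fin n)} : z ∈ newPairs G x y ↔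
    (∃ c ∈ commonNbrs G x y, s((x, y), (y, c)) = z) ∨
    (∃ c ∈ commonNbrs G x y, s((c, x), (x, y)) = z) ∨
    (∃ c ∈ commonNbrs G x y, (∀ d ∈ commonNbrs G x y, c ≤ d) ∧ s((x, c), (c, y)) = z) ∨
    (∃ d ∈ quadPairs G x y, s((x, d.1), (d.2, y)) = z) ∨
    (∃ d ∈ firstQuadPairs G x y, s((x, d.1), (d.1, d.2)) = z) ∨
    (∃ d ∈ firstQuadPairs G x y, s((d.2, d.1), (d.1, x)) = z) := by
  simp only [newPairs, Finset.mem_union, Finset.mem_image, Finset.mem_filter, or_assoc, and_assoc]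

theorem deleteEdge_adj {a b : Fin n} : (G.deleteEdges {s(x, y)}).Adj a b ↔
    G.Adj a b ∧ ¬ (a = x ∧ b = y) ∧ ¬ (a = y ∧ b = x) := by
  simp [SimpleGraph.deleteEdges_adj]

theorem path_mem_of_commonNbr (hxy : x ≠ y) {c : Fin n} (hc : c ∈ commonNbrs G x y) :
    s((x, c), (c, y)) ∈ badPairs (G.deleteEdges {s(x, y)}) (edgeOrder x y) ∨
      s((x, c), (c, y)) ∈ newPairs G x y := by
  by_cases hmin : ∀ d ∈ commonNbrs G x y, c ≤ d
  · exact Or.inr (mem_newPairs.2 (Or.inr (Or.inr (Or.inl ⟨c, hc, hmin, rfl⟩))))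
  · push Not at hmin
    obtain ⟨d, hd, hdc⟩ := hmin
    left
    rw [mem_commonNbrs] at hc hd
    obtain ⟨hxc, hyc⟩ := hc
    obtain ⟨hxd, hyd⟩ := hd
    have := hxc.ne
    have := hyc.ne
    have := hxd.ne
    have := hyd.ne
    have hrank : edgeRank x y s(d, x) = d + 1 := by
      rw [Sym2.eq_swap, edgeRank_star] <;> grind
    have hdc : d.val < c.val := hdc
    refine IsQuad.mem_badPairs_adjacent (r := y) (s := d) (q := c) ?_ ?_ ?_
    · simp only [IsQuad, deleteEdge_adj]
      grind [hyc.symm, hxd.symm]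
    · refine Or.inr (Or.inr (Or.inr (edgeOrder_of_rank_lt ?_)))
      rw [hrank, edgeRank_star] <;> grind
    · refine Or.inr (Or.inr (Or.inr (edgeOrder_of_rank_lt ?_)))
      rw [hrank, Sym2.eq_swap, edgeRank_star] <;> grind

theorem path_mem_of_isQuad {q r : Fin n} (h : IsQuad G x q r y) :
    (s((x, q), (q, r)) ∈ badPairs (G.deleteEdges {s(x, y)}) (edgeOrder x y) ∨
      s((x, q), (q, r)) ∈ newPairs G x y) ∧
    (s((r, q), (q, x)) ∈ badPairs (G.deleteEdges {s(x, y)}) (edgeOrder x y) ∨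
      s((r, q), (q, x)) ∈ newPairs G x y) := by
  obtain ⟨hxq, hqr, hry, hyx, hne₁, hne₂⟩ := h
  have hxq' := hxq.ne
  have hqr' := hqr.ne
  have hry' := hry.ne
  have hyx' := hyx.ne
  have hmem : (q, r) ∈ quadPairs G x y :=
    mem_quadPairs.2 ⟨⟨hxq, hne₂⟩, ⟨hry.symm, hne₁.symm⟩, hqr⟩
  by_cases hxr : G.Adj x r
  · refine ⟨Or.inl ?_, Or.inl ?_⟩ <;> refine mem_badPairs_of_triangle ?_ ?_ ?_ <;>
      rw [deleteEdge_adj] <;> grind [hxr.symm, hqr.symm, hxq.symm]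
  by_cases hmin : ∀ a, (a, r) ∈ quadPairs G x y → q ≤ a
  · have hfirst := mem_firstQuadPairs.2 ⟨hmem, hxr, hmin⟩
    exact ⟨Or.inr (mem_newPairs.2 (Or.inr (Or.inr (Or.inr (Or.inr (Or.inl ⟨_, hfirst, rfl⟩)))))),
      Or.inr (mem_newPairs.2 (Or.inr (Or.inr (Or.inr (Or.inr (Or.inr ⟨_, hfirst, rfl⟩))))))⟩
  push Not at hmin
  obtain ⟨d, hd, hdq⟩ := hmin
  obtain ⟨⟨hxd, hdy⟩, -, hdr⟩ := mem_quadPairs.1 hd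
  have hxd' := hxd.ne
  have hdr' := hdr.ne
  have hdq : d.val < q.val := hdq
  have hQ : IsQuad (G.deleteEdges {s(x, y)}) x q r d := by
    simp only [IsQuad, deleteEdge_adj]
    grind [hxd.symm, hdr.symm]
  have hQ' : IsQuad (G.deleteEdges {s(x, y)}) r q x d := by
    simp only [IsQuad, deleteEdge_adj]
    grind [hxq.symm, hqr.symm]
  have h₁ : edgeOrder x y s(x, d) s(x, q) := edgeOrder_of_rank_lt (by
    rw [edgeRank_star, edgeRank_star] <;> grind)
  have h₂ : edgeOrder x y s(x, d) s(q, r) := edgeOrder_of_rank_lt (by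
    rw [edgeRank_star, edgeRank_away] <;> grind)
  refine ⟨Or.inl (hQ.mem_badPairs_adjacent ?_ ?_), Or.inl (hQ'.mem_badPairs_adjacent ?_ ?_)⟩ <;>
    simp only [QuadBelow, Sym2.eq_swap (a := d) (b := x), Sym2.eq_swap (a := r) (b := q),
      Sym2.eq_swap (a := q) (b := x), h₁, h₂, true_or, or_true]

theorem triangle_mem_newPairs {c : Fin n} (hxc : G.Adj x c) (hyc : G.Adj y c) :
    s((x, y), (y, c)) ∈ newPairs G x y ∧ s((c, x), (x, y)) ∈ newPairs G x y := by
  have hc := mem_commonNbrs.2 ⟨hxc, hyc⟩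
  exact ⟨mem_newPairs.2 (Or.inl ⟨c, hc, rfl⟩), mem_newPairs.2 (Or.inr (Or.inl ⟨c, hc, rfl⟩))⟩

theorem opposite_mem_newPairs {q r : Fin n} (h : IsQuad G x q r y) :
    s((x, q), (r, y)) ∈ newPairs G x y := by
  obtain ⟨hxq, hqr, hry, hyx, hne₁, hne₂⟩ := h
  refine mem_newPairs.2 (Or.inr (Or.inr (Or.inr (Or.inl ⟨(q, r), ?_, rfl⟩))))
  exact mem_quadPairs.2 ⟨⟨hxq, hne₂⟩, ⟨hry.symm, hne₁.symm⟩, hqr⟩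

/-- A bad pair lying on a 3- or 4-cycle through the edge `s(x, y)` survives its deletion or is
counted by `newPairs`. -/
theorem badPairs_subset (hxy : G.Adj x y) :
    badPairs G (edgeOrder x y) ⊆ badPairs (G.deleteEdges {s(x, y)}) (edgeOrder x y) ∪
      ↑(newPairs G x y ∪ newPairs G y x) := by
  intro z hz
  simp only [Finset.coe_union, Set.mem_union, Finset.mem_coe]
  have hcomm : badPairs (G.deleteEdges {s(y, x)}) (edgeOrder y x) =
      badPairs (G.deleteEdges {s(x, y)}) (edgeOrder x y) := by
    rw [Sym2.eq_swap, edgeOrder_comm]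
  have hwitness {a b : Fin n} (hab : G.Adj a b) {p q r s : Fin n} (hQ : IsQuad G p q r s)
      (h : QuadBelow (edgeOrder x y) p q r s s(a, b)) :
      ¬ (a = x ∧ b = y) ∧ ¬ (a = y ∧ b = x) := by
    have hne : s(a, b) ≠ s(x, y) := by
      intro he
      rw [he] at h
      rcases h with h | h | h | h
      · exact not_edgeOrder_self hQ.1.ne h
      · exact not_edgeOrder_self hQ.2.1.ne h
      · exact not_edgeOrder_self hQ.2.2.1.ne h
      · exact not_edgeOrder_self hQ.2.2.2.1.ne h
    rw [ne_eq, Sym2.eq_iff] at hne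
    tauto
  have hdel {p q r s : Fin n} (hQ : IsQuad G p q r s)
      (h₁ : ¬ (p = x ∧ q = y) ∧ ¬ (p = y ∧ q = x)) (h₂ : ¬ (q = x ∧ r = y) ∧ ¬ (q = y ∧ r = x))
      (h₃ : ¬ (r = x ∧ s = y) ∧ ¬ (r = y ∧ s = x))
      (h₄ : ¬ (s = x ∧ p = y) ∧ ¬ (s = y ∧ p = x)) :
      IsQuad (G.deleteEdges {s(x, y)}) p q r s :=
    ⟨deleteEdge_adj.2 ⟨hQ.1, h₁⟩, deleteEdge_adj.2 ⟨hQ.2.1, h₂⟩,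
      deleteEdge_adj.2 ⟨hQ.2.2.1, h₃⟩, deleteEdge_adj.2 ⟨hQ.2.2.2.1, h₄⟩, hQ.2.2.2.2⟩
  rcases exists_cycle_of_mem_badPairs hz with
    ⟨a, b, c, hab, hbc, hca, rfl⟩ | ⟨p, q, r, s, hQ, h₁, h₂⟩
  · by_cases h₁ : (a = x ∧ b = y) ∨ (a = y ∧ b = x)
    · rcases h₁ with ⟨rfl, rfl⟩ | ⟨rfl, rfl⟩
      · exact Or.inr (Or.inl (triangle_mem_newPairs hca.symm hbc).1)
      · exact Or.inr (Or.inr (triangle_mem_newPairs hca.symm hbc).1)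
    by_cases h₂ : (b = x ∧ c = y) ∨ (b = y ∧ c = x)
    · rcases h₂ with ⟨rfl, rfl⟩ | ⟨rfl, rfl⟩
      · exact Or.inr (Or.inl (triangle_mem_newPairs hab.symm hca).2)
      · exact Or.inr (Or.inr (triangle_mem_newPairs hab.symm hca).2)
    by_cases h₃ : (c = x ∧ a = y) ∨ (c = y ∧ a = x)
    · rcases h₃ with ⟨rfl, rfl⟩ | ⟨rfl, rfl⟩
      · have := path_mem_of_commonNbr hxy.ne.symm (mem_commonNbrs.2 ⟨hab, hbc.symm⟩)
        rw [hcomm] at this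
        exact this.imp id Or.inr
      · have := path_mem_of_commonNbr hxy.ne (mem_commonNbrs.2 ⟨hab, hbc.symm⟩)
        exact this.imp id Or.inl
    · left
      exact mem_badPairs_of_triangle (deleteEdge_adj.2 ⟨hab, not_or.1 h₁⟩)
        (deleteEdge_adj.2 ⟨hbc, not_or.1 h₂⟩) (deleteEdge_adj.2 ⟨hca, not_or.1 h₃⟩)
  · rcases h₂ with ⟨h₂, rfl⟩ | ⟨h₂, rfl⟩
    · have h₁' := hwitness hQ.1 hQ h₁
      have h₂' := hwitness hQ.2.1 hQ h₂
      by_cases h₃ : (r = x ∧ s = y) ∨ (r = y ∧ s = x)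
      · rcases h₃ with ⟨rfl, rfl⟩ | ⟨rfl, rfl⟩
        · have := (path_mem_of_isQuad hQ.reverse).2
          exact this.imp id Or.inl
        · have := (path_mem_of_isQuad hQ.reverse).2
          rw [hcomm] at this
          exact this.imp id Or.inr
      by_cases h₄ : (s = x ∧ p = y) ∨ (s = y ∧ p = x)
      · rcases h₄ with ⟨rfl, rfl⟩ | ⟨rfl, rfl⟩
        · have := (path_mem_of_isQuad hQ).1
          rw [hcomm] at this
          exact this.imp id Or.inr
        · have := (path_mem_of_isQuad hQ).1
          exact this.imp id Or.inl
      exact Or.inl (IsQuad.mem_badPairs_adjacent (hdel hQ h₁' h₂' (not_or.1 h₃) (not_or.1 h₄)) h₁ h₂)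
    · have h₁' := hwitness hQ.1 hQ h₁
      have h₂' := hwitness hQ.2.2.1 hQ h₂
      by_cases h₃ : (q = x ∧ r = y) ∨ (q = y ∧ r = x)
      · rcases h₃ with ⟨rfl, rfl⟩ | ⟨rfl, rfl⟩
        · have := opposite_mem_newPairs hQ.rotate.rotate
          rw [Sym2.eq_swap] at this
          exact Or.inr (Or.inr this)
        · have := opposite_mem_newPairs hQ.rotate.rotate
          rw [Sym2.eq_swap] at this
          exact Or.inr (Or.inl this)
      by_cases h₄ : (s = x ∧ p = y) ∨ (s = y ∧ p = x)
      · rcases h₄ with ⟨rfl, rfl⟩ | ⟨rfl, rfl⟩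
        · have := opposite_mem_newPairs hQ
          exact Or.inr (Or.inr this)
        · have := opposite_mem_newPairs hQ
          exact Or.inr (Or.inl this)
      exact Or.inl (IsQuad.mem_badPairs_opposite (hdel hQ h₁' (not_or.1 h₃) h₂' (not_or.1 h₄)) h₁ h₂)

end

section

variable {n : ℕ} {G : SimpleGraph (Fin n)} {x y : Fin n}

theorem card_firstQuadPairs_le [DecidableRel G.Adj] :
    (firstQuadPairs G x y).card ≤
      ({b | G.Adj y b ∧ b ≠ x ∧ ¬ G.Adj x b} : Finset (Fin n)).card := by
  refine Finset.card_le_card_of_injOn Prod.snd ?_ ?_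
  · rintro ⟨a, b⟩ h
    obtain ⟨h₁, h₂, -⟩ := mem_firstQuadPairs.1 h
    obtain ⟨-, h₃, -⟩ := mem_quadPairs.1 h₁
    simp [h₂, h₃]
  · rintro ⟨a, b⟩ h ⟨a', b'⟩ h' (rfl : b = b')
    obtain ⟨h₁, -, h₂⟩ := mem_firstQuadPairs.1 h
    obtain ⟨h₁', -, h₂'⟩ := mem_firstQuadPairs.1 h'
    rw [le_antisymm (h₂ _ h₁') (h₂' _ h₁)]

theorem card_newPairs_le :
    (newPairs G x y).card ≤ 2 * (commonNbrs G x y).card + 1 + (quadPairs G x y).card +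
      2 * (firstQuadPairs G x y).card := by
  have hfirst : ({c ∈ commonNbrs G x y | ∀ d ∈ commonNbrs G x y, c ≤ d}).card ≤ 1 := by
    refine Finset.card_le_one.2 fun a ha b hb => ?_
    rw [Finset.mem_filter] at ha hb
    exact le_antisymm (ha.2 _ hb.1) (hb.2 _ ha.1)
  unfold newPairs
  refine ((Finset.card_union_le _ _).trans (Nat.add_le_add ((Finset.card_union_le _ _).trans
    (Nat.add_le_add ((Finset.card_union_le _ _).trans (Nat.add_le_add
      ((Finset.card_union_le _ _).trans (Nat.add_le_add ((Finset.card_union_le _ _).trans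
        (Nat.add_le_add Finset.card_image_le Finset.card_image_le))
          (Finset.card_image_le.trans hfirst))) Finset.card_image_le))
            Finset.card_image_le)) Finset.card_image_le)).trans ?_
  omega

theorem n1_le (hxy : G.Adj x y) :
    n1 G (edgeOrder x y) ≤ n1 (G.deleteEdges {s(x, y)}) (edgeOrder x y) +
      ((newPairs G x y).card + (newPairs G y x).card) := by
  rw [n1_eq_ncard_badPairs, n1_eq_ncard_badPairs]
  refine (Set.ncard_le_ncard (badPairs_subset hxy) (Set.toFinite _)).trans ?_
  refine (Set.ncard_union_le _ _).trans (Nat.add_le_add_left ?_ _)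
  rw [Set.ncard_coe_finset]
  exact Finset.card_union_le _ _

/-- The weighted count of edges behind the estimate of the number of new bad pairs: `M` is the
adjacency matrix of a graph on `W`, while `A` and `B` indicate adjacency to the ends of the
deleted edge. -/
theorem sum_weighted_le {V : Type*} (W : Finset V) (M : V → V → ℤ) (A B : V → ℤ)
    (hM : ∀ a b, M a b = M b a) (hM₀ : ∀ a b, 0 ≤ M a b)
    (hA : ∀ a, A a = 0 ∨ A a = 1) (hB : ∀ a, B a = 0 ∨ B a = 1)
    (hdeg : ∀ a ∈ W, 3 ≤ A a + B a + ∑ b ∈ W, M a b) :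
    ∑ a ∈ W, ∑ b ∈ W, A a * B b * M a b + ∑ a ∈ W, (2 - A a - B a) ≤
      ∑ a ∈ W, ∑ b ∈ W, M a b := by
  have h₁ : 2 * ∑ a ∈ W, ∑ b ∈ W, A a * B b * M a b ≤
      ∑ a ∈ W, ∑ b ∈ W, (A a + B b) * M a b := by
    simp only [Finset.mul_sum]
    refine Finset.sum_le_sum fun a _ => Finset.sum_le_sum fun b _ => ?_
    have := hM₀ a b
    rcases hA a with ha | ha <;> rcases hB b with hb | hb <;> rw [ha, hb] <;> linarith
  have h₂ : ∑ a ∈ W, ∑ b ∈ W, (A a + B b) * M a b =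
      ∑ a ∈ W, (A a + B a) * ∑ b ∈ W, M a b := by
    simp only [add_mul, Finset.sum_add_distrib, Finset.mul_sum]
    congr 1
    rw [Finset.sum_comm]
    exact Finset.sum_congr rfl fun a _ => Finset.sum_congr rfl fun b _ => by rw [hM]
  have h₃ : 2 * ∑ a ∈ W, (2 - A a - B a) ≤
      ∑ a ∈ W, (2 - A a - B a) * ∑ b ∈ W, M a b := by
    rw [Finset.mul_sum]
    refine Finset.sum_le_sum fun a ha => ?_
    have := hdeg a ha
    rcases hA a with ha | ha <;> rcases hB a with hb | hb <;> rw [ha, hb] at this ⊢ <;> linarith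
  have h₄ : ∑ a ∈ W, (2 - A a - B a) * ∑ b ∈ W, M a b =
      2 * (∑ a ∈ W, ∑ b ∈ W, M a b) - ∑ a ∈ W, (A a + B a) * ∑ b ∈ W, M a b := by
    rw [Finset.mul_sum, ← Finset.sum_sub_distrib]
    exact Finset.sum_congr rfl fun a _ => by ring
  linarith

theorem sum_univ_eq_add_add {u v : Fin n} (huv : u ≠ v) (f : Fin n → ℤ) :
    ∑ a, f a = f u + f v + ∑ a with a ≠ u ∧ a ≠ v, f a := by
  rw [← Finset.sum_filter_add_sum_filter_not Finset.univ (fun a => a ≠ u ∧ a ≠ v), add_comm]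
  congr 1
  rw [← Finset.sum_pair huv]
  refine Finset.sum_congr ?_ fun _ _ => rfl
  ext a
  simp only [Finset.mem_filter, Finset.mem_univ, Finset.mem_insert, Finset.mem_singleton]
  tauto

/-- Deleting the edge `s(u, v)` destroys at most `4 cy(G) + 2` bad pairs. -/
theorem card_newPairs_add_le {u v : Fin n} (huv : G.Adj u v)
    (hdeg : ∀ v : Fin n, 3 ≤ (G.neighborSet v).ncard) :
    ((newPairs G u v).card + (newPairs G v u).card : ℤ) ≤
      4 * ((G.edgeSet.ncard : ℤ) + 1 - n) + 2 := by
  classical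
  let M : Fin n → Fin n → ℤ := fun a b => if G.Adj a b then 1 else 0
  have hM (a b : Fin n) : M a b = M b a := by simp only [M, G.adj_comm]
  have hM₀₁ (a b : Fin n) : M a b = 0 ∨ M a b = 1 := by grind
  have hM₀ (a b : Fin n) : 0 ≤ M a b := by grind
  have hdegM (a : Fin n) : ((G.neighborSet a).ncard : ℤ) = ∑ b, M a b := by
    simp [M, Set.ncard_eq_toFinset_card', Finset.sum_boole]
  have hedge : 2 * (G.edgeSet.ncard : ℤ) = ∑ a, ∑ b, M a b := by
    have h₁ : (∑ a, G.degree a : ℤ) = 2 * G.edgeFinset.card := by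
      exact_mod_cast G.sum_degrees_eq_twice_card_edges
    rw [Set.ncard_eq_toFinset_card' G.edgeSet, ← SimpleGraph.edgeFinset, ← h₁]
    refine Finset.sum_congr rfl fun a _ => ?_
    rw [← hdegM, Set.ncard_eq_toFinset_card', ← SimpleGraph.neighborFinset,
      SimpleGraph.card_neighborFinset_eq_degree]
  let W : Finset (Fin n) := {a | a ≠ u ∧ a ≠ v}
  have hcommon (x y : Fin n) (h : x = u ∧ y = v ∨ x = v ∧ y = u) :
      ((commonNbrs G x y).card : ℤ) = ∑ a ∈ W, M u a * M v a := by
    have : commonNbrs G x y = {a ∈ W | G.Adj u a ∧ G.Adj v a} := by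
      ext a
      simp only [mem_commonNbrs, W, Finset.mem_filter, Finset.mem_univ]
      grind [SimpleGraph.Adj.ne]
    rw [this, Finset.card_filter]
    push_cast
    exact Finset.sum_congr rfl fun a _ => by grind
  have hquad (x y : Fin n) (h : x = u ∧ y = v ∨ x = v ∧ y = u) :
      ((quadPairs G x y).card : ℤ) = ∑ a ∈ W, ∑ b ∈ W, M x a * M y b * M a b := by
    have : quadPairs G x y =
        {d ∈ W ×ˢ W | G.Adj x d.1 ∧ G.Adj y d.2 ∧ G.Adj d.1 d.2} := by
      ext ⟨a, b⟩
      simp only [mem_quadPairs, W, Finset.mem_filter, Finset.mem_univ, Finset.mem_product]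
      grind [SimpleGraph.Adj.ne]
    rw [this, Finset.card_filter, Finset.sum_product]
    push_cast
    exact Finset.sum_congr rfl fun a _ => Finset.sum_congr rfl fun b _ => by grind
  have hfirst (x y : Fin n) (h : x = u ∧ y = v ∨ x = v ∧ y = u) :
      ((firstQuadPairs G x y).card : ℤ) ≤ ∑ a ∈ W, M y a * (1 - M x a) := by
    have : ({b | G.Adj y b ∧ b ≠ x ∧ ¬ G.Adj x b} : Finset (Fin n)) =
        {b ∈ W | G.Adj y b ∧ ¬ G.Adj x b} := by
      ext a
      simp only [W, Finset.mem_filter, Finset.mem_univ]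
      grind [SimpleGraph.Adj.ne]
    refine (Nat.cast_le.2 card_firstQuadPairs_le).trans (le_of_eq ?_)
    rw [this, Finset.card_filter]
    push_cast
    exact Finset.sum_congr rfl fun a _ => by grind
  have hrow (a : Fin n) : ∑ b, M a b = M u a + M v a + ∑ b ∈ W, M a b := by
    rw [sum_univ_eq_add_add huv.ne, hM a u, hM a v]
  have hkey := sum_weighted_le W M (M u) (M v) hM hM₀ (hM₀₁ u) (hM₀₁ v) fun a _ => by
    rw [← hrow, ← hdegM]
    exact_mod_cast hdeg a
  have hn : (n : ℤ) = 2 + ∑ a ∈ W, 1 := by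
    have := sum_univ_eq_add_add huv.ne (fun _ => (1 : ℤ))
    simpa using this
  have hsum : ∑ a, ∑ b, M a b = 2 + 2 * ∑ a ∈ W, M u a + 2 * ∑ a ∈ W, M v a +
      ∑ a ∈ W, ∑ b ∈ W, M a b := by
    have huu : M u u = 0 := by simp [M]
    have hvv : M v v = 0 := by simp [M]
    have huv' : M u v = 1 := by simp [M, huv]
    rw [sum_univ_eq_add_add huv.ne (fun a => ∑ b, M a b)]
    simp only [hrow,
      Finset.sum_add_distrib, huu, hvv, hM v u, huv']
    ring
  have hswap : ∑ a ∈ W, ∑ b ∈ W, M v a * M u b * M a b =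
      ∑ a ∈ W, ∑ b ∈ W, M u a * M v b * M a b := by
    rw [Finset.sum_comm]
    exact Finset.sum_congr rfl fun a _ => Finset.sum_congr rfl fun b _ => by
      rw [hM b a]
      ring
  have hcomm : ∑ a ∈ W, M v a * M u a = ∑ a ∈ W, M u a * M v a :=
    Finset.sum_congr rfl fun a _ => mul_comm _ _
  have h₁ := hcommon u v (by simp)
  have h₂ := hcommon v u (by simp)
  have h₃ := hquad u v (by simp)
  have h₄ := hquad v u (by simp)
  have h₅ := hfirst u v (by simp)
  have h₆ := hfirst v u (by simp)
  have h₇ : ((newPairs G u v).card : ℤ) ≤ _ := Nat.cast_le.2 card_newPairs_le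
  have h₈ : ((newPairs G v u).card : ℤ) ≤ _ := Nat.cast_le.2 card_newPairs_le
  push_cast at h₇ h₈
  simp only [mul_sub, mul_one, Finset.sum_sub_distrib, hcomm] at h₅ h₆ hkey
  have htwo : ∑ a ∈ W, (2 : ℤ) = 2 * ∑ a ∈ W, 1 := by simp [mul_comm]
  linarith

end

theorem connected_deleteEdges_of_mem_cycle {V : Type*} {G : SimpleGraph V} (hG : G.Connected)
    {e : Sym2 V} {u : V} {w : G.Walk u u} (hw : w.IsCycle) (he : e ∈ w.edges) :
    (G.deleteEdges {e}).Connected := by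
  induction e with | _ x y
  exact hG.connected_delete_edge_of_not_isBridge fun h => h.notMem_edges_of_isCycle hw he

theorem cyc_of_connected {n : ℕ} {G : SimpleGraph (Fin n)} (hG : G.Connected) :
    cyc G = (G.edgeSet.ncard : ℤ) + 1 - n := by
  have := hG.preconnected.subsingleton_connectedComponent
  have := hG.nonempty
  rw [cyc, Nat.card_eq_fintype_card (α := Fin n), Fintype.card_fin, Nat.card_unique]
  rfl

theorem cyc_deleteEdges {n : ℕ} {G : SimpleGraph (Fin n)} (hG : G.Connected) {e : Sym2 (Fin n)}
    (he : e ∈ G.edgeSet) (hc : (G.deleteEdges {e}).Connected) :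
    cyc (G.deleteEdges {e}) = cyc G - 1 := by
  rw [cyc_of_connected hG, cyc_of_connected hc, SimpleGraph.edgeSet_deleteEdges]
  have := Set.ncard_sdiff_singleton_add_one he
  push_cast [← this]
  ring

open Filter in
theorem stmt6 {n : ℕ} (G : SimpleGraph (Fin n)) (hG : TwoConnected G)
    (hcyc : ∀ e ∈ G.edgeSet, ∃ (u : Fin n) (w : G.Walk u u),
      w.IsCycle ∧ (w.length = 3 ∨ w.length = 4) ∧ e ∈ w.edges)
    (hdeg : ∀ v : Fin n, 3 ≤ (G.neighborSet v).ncard)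
    (e : Sym2 (Fin n)) (he : e ∈ G.edgeSet) :
    ∃ elt : Sym2 (Fin n) → Sym2 (Fin n) → Prop,
      IsStrictTotalOrder (Sym2 (Fin n)) elt ∧
        gammaTwo (G.deleteEdges {e}) elt ≤ gammaTwo G elt := by
  obtain ⟨u, w, hw, -, hew⟩ := hcyc e he
  have hconn := connected_deleteEdges_of_mem_cycle hG.1 hw hew
  induction e with | _ x y
  refine ⟨edgeOrder x y, edgeOrder_isStrictTotalOrder x y, ?_⟩
  have hcount := card_newPairs_add_le he hdeg
  have hn1 : (n1 G (edgeOrder x y) : ℤ) ≤ _ := Nat.cast_le.2 (n1_le he)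
  rw [← cyc_of_connected hG.1] at hcount
  rw [gammaTwo, gammaTwo, cyc_deleteEdges hG.1 he hconn]
  push_cast at hn1
  linarith

end SEP
end

section
/- For every finite simple graph G and every total order < on its edge set E, the number of bad pairs satisfies n_1(G,<) ≤ 2·cy(G)·(cy(G)+2); equivalently, γ₂(G,<) ≥ 0, i.e., the second γ-vector entry of the symmetric edge polytope of G is nonnegative. -/
open SimpleGraph Finset Filter

namespace SEP

section Cyclomatic

variable {V : Type*} {G : SimpleGraph V} {u v : V}

lemma deleteEdge_adj_iff {x y : V} :
    (G.deleteEdges {s(u, v)}).Adj x y ↔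
      G.Adj x y ∧ ¬ (x = u ∧ y = v) ∧ ¬ (x = v ∧ y = u) := by
  rw [deleteEdges_adj, Set.mem_singleton_iff, Sym2.eq_iff, not_or]

lemma surjective_map_deleteEdge :
    Function.Surjective
      (ConnectedComponent.map (Hom.ofLE (G.deleteEdges_le {s(u, v)}))) := by
  intro c
  induction c using ConnectedComponent.ind with
  | h x => exact ⟨(G.deleteEdges {s(u, v)}).connectedComponentMk x, rfl⟩

/-- Vertices joined in `G` are either joined in `G` minus an edge, or each is joined to an
end of that edge. -/
lemma reachable_deleteEdge_or {x y : V} (h : G.Reachable x y) :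
    (G.deleteEdges {s(u, v)}).Reachable x y ∨
      (((G.deleteEdges {s(u, v)}).Reachable x u ∨ (G.deleteEdges {s(u, v)}).Reachable x v) ∧
       ((G.deleteEdges {s(u, v)}).Reachable y u ∨
        (G.deleteEdges {s(u, v)}).Reachable y v)) := by
  obtain ⟨w⟩ := h
  induction w with
  | nil => exact Or.inl (Reachable.refl _)
  | @cons x z y hxz w ih =>
    by_cases h1 : (G.deleteEdges {s(u, v)}).Adj x z
    · have hr := h1.reachable
      rcases ih with ih | ⟨ih1 | ih1, ih2⟩
      · exact Or.inl (hr.trans ih)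
      · exact Or.inr ⟨Or.inl (hr.trans ih1), ih2⟩
      · exact Or.inr ⟨Or.inr (hr.trans ih1), ih2⟩
    · have h2 : (x = u ∧ z = v) ∨ (x = v ∧ z = u) := by
        rw [deleteEdge_adj_iff] at h1
        tauto
      right
      rcases h2 with ⟨rfl, rfl⟩ | ⟨rfl, rfl⟩
      · refine ⟨Or.inl (Reachable.refl _), ?_⟩
        rcases ih with ih | ih
        · exact Or.inr ih.symm
        · exact ih.2
      · refine ⟨Or.inr (Reachable.refl _), ?_⟩
        rcases ih with ih | ih
        · exact Or.inl ih.symm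
        · exact ih.2

lemma reachable_eq_of_isolated {x y : V} (hx : ∀ z, ¬ G.Adj x z) (h : G.Reachable x y) :
    x = y := by
  obtain ⟨w⟩ := h
  cases w with
  | nil => rfl
  | cons h _ => exact absurd h (hx _)

lemma card_connectedComponent_deleteEdge_of_reachable
    (hr : (G.deleteEdges {s(u, v)}).Reachable u v) :
    Nat.card (G.deleteEdges {s(u, v)}).ConnectedComponent =
      Nat.card G.ConnectedComponent := by
  refine Nat.card_eq_of_bijective _ ⟨?_, surjective_map_deleteEdge⟩
  intro c d
  induction c using ConnectedComponent.ind with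
  | h x =>
  induction d using ConnectedComponent.ind with
  | h y =>
  intro hxy
  have hxy' : G.Reachable x y := ConnectedComponent.exact hxy
  refine ConnectedComponent.sound ?_
  rcases reachable_deleteEdge_or (u := u) (v := v) hxy' with h | ⟨h1 | h1, h2 | h2⟩
  · exact h
  · exact h1.trans h2.symm
  · exact h1.trans (hr.trans h2.symm)
  · exact h1.trans (hr.symm.trans h2.symm)
  · exact h1.trans h2.symm

variable [Fintype V]

lemma ncard_edgeSet_deleteEdge (h : G.Adj u v) :
    ((G.deleteEdges {s(u, v)}).edgeSet.ncard : ℤ) + 1 = G.edgeSet.ncard := by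
  rw [edgeSet_deleteEdges]
  exact_mod_cast Set.ncard_sdiff_singleton_add_one (by simpa using h) (Set.toFinite _)

lemma card_connectedComponent_deleteEdge_le :
    Nat.card (G.deleteEdges {s(u, v)}).ConnectedComponent ≤
      Nat.card G.ConnectedComponent + 1 := by
  classical
  let f : (G.deleteEdges {s(u, v)}).ConnectedComponent → Option G.ConnectedComponent :=
    fun c => if c = connectedComponentMk _ v then none
      else some (c.map (Hom.ofLE (G.deleteEdges_le {s(u, v)})))
  have hf : Function.Injective f := by
    intro c d
    induction c using ConnectedComponent.ind with
    | h x =>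
    induction d using ConnectedComponent.ind with
    | h y =>
    intro hxy
    simp only [f] at hxy
    split_ifs at hxy with h1 h2 h2
    · rw [h1, h2]
    · have hxy' : G.Reachable x y := ConnectedComponent.exact (Option.some.inj hxy)
      rw [ConnectedComponent.eq] at h1 h2 ⊢
      rcases reachable_deleteEdge_or (u := u) (v := v) hxy' with h | ⟨h3, h4⟩
      · exact h
      · exact (h3.resolve_right h1).trans (h4.resolve_right h2).symm
  have := Nat.card_le_card_of_injective f hf
  rwa [Finite.card_option] at this

lemma cyc_deleteEdge_of_reachable (h : G.Adj u v)
    (hr : (G.deleteEdges {s(u, v)}).Reachable u v) :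
    cyc (G.deleteEdges {s(u, v)}) = cyc G - 1 := by
  have h1 := ncard_edgeSet_deleteEdge h
  have h2 := card_connectedComponent_deleteEdge_of_reachable hr
  unfold cyc
  rw [h2]
  linarith

lemma cyc_deleteEdge_le (h : G.Adj u v) :
    cyc (G.deleteEdges {s(u, v)}) ≤ cyc G := by
  have h1 := ncard_edgeSet_deleteEdge h
  have h2 : (Nat.card (G.deleteEdges {s(u, v)}).ConnectedComponent : ℤ) ≤
      Nat.card G.ConnectedComponent + 1 := by
    exact_mod_cast card_connectedComponent_deleteEdge_le
  unfold cyc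
  linarith

open Classical in
lemma card_isolated_lt_card_connectedComponent (h : G.Adj u v) :
    #{x : V | G.degree x = 0} + 1 ≤ Nat.card G.ConnectedComponent := by
  have key : ∀ {x : V}, G.degree x = 0 → ∀ z, ¬ G.Adj x z := by
    intro x hx z hz
    exact (G.degree_pos_iff_exists_adj x).2 ⟨z, hz⟩ |>.ne' hx
  let f : Option {x : V // G.degree x = 0} → G.ConnectedComponent :=
    fun o => o.elim (G.connectedComponentMk u) fun x => G.connectedComponentMk x
  have hf : Function.Injective f := by
    rintro (_ | ⟨x, hx⟩) (_ | ⟨y, hy⟩) hxy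
    · rfl
    · have := reachable_eq_of_isolated (key hy) (ConnectedComponent.exact hxy).symm
      exact absurd h (this ▸ key hy v)
    · have := reachable_eq_of_isolated (key hx) (ConnectedComponent.exact hxy)
      exact absurd h (this ▸ key hx v)
    · have := reachable_eq_of_isolated (key hx) (ConnectedComponent.exact hxy)
      subst this
      rfl
  have := Nat.card_le_card_of_injective f hf
  rwa [Finite.card_option, Nat.card_eq_fintype_card, Fintype.card_subtype] at this

open Classical in
lemma two_add_sum_degree_sub_two_le_cyc (h : G.Adj u v) :
    2 + ∑ x, (if G.degree x = 0 then (0 : ℤ) else G.degree x - 2) ≤ 2 * cyc G := by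
  have h1 : (#{x : V | G.degree x = 0} : ℤ) + 1 ≤ Nat.card G.ConnectedComponent := by
    exact_mod_cast card_isolated_lt_card_connectedComponent h
  have h2 : ∑ x, (G.degree x : ℤ) = 2 * G.edgeSet.ncard := by
    have := G.sum_degrees_eq_twice_card_edges
    rw [← coe_edgeFinset, Set.ncard_coe_finset]
    exact_mod_cast this
  have h3 : ∑ x, (if G.degree x = 0 then (0 : ℤ) else G.degree x - 2) =
      ∑ x, (G.degree x : ℤ) - 2 * Fintype.card V + 2 * #{x : V | G.degree x = 0} := by
    have : ∀ x, (if G.degree x = 0 then (0 : ℤ) else G.degree x - 2) =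
        G.degree x - 2 + 2 * (if G.degree x = 0 then 1 else 0) := by
      intro x
      split_ifs with hx <;> simp [hx]
    simp only [this, Finset.sum_add_distrib, Finset.sum_sub_distrib, ← Finset.mul_sum,
      Finset.sum_boole, Finset.sum_const, Finset.card_univ]
    simp [mul_comm]
  rw [h3, h2]
  unfold cyc
  rw [Nat.card_eq_fintype_card (α := V)]
  linarith

end Cyclomatic

section CodegreeEnergy

open Classical in
/-- The number of common neighbours of two vertices. -/
noncomputable def codegree {V : Type*} [Fintype V] (G : SimpleGraph V) (i k : V) : ℕ :=
  #{j : V | G.Adj i j ∧ G.Adj k j}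

open Classical in
/-- The contribution of an ordered pair of vertices to four times the number of bad pairs. -/
noncomputable def pairEnergy {V : Type*} [Fintype V] (G : SimpleGraph V) (i k : V) : ℤ :=
  if i = k ∨ codegree G i k = 0 then 0
  else (codegree G i k : ℤ) ^ 2 + 3 * codegree G i k - if G.Adj i k then 0 else 4

variable {V : Type*} [Fintype V] {G : SimpleGraph V} {u v : V}

lemma codegree_comm (i k : V) : codegree G i k = codegree G k i := by
  unfold codegree
  congr 1
  ext j
  simp only [Finset.mem_filter, and_comm]

lemma pairEnergy_comm (i k : V) : pairEnergy G i k = pairEnergy G k i := by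
  unfold pairEnergy
  rw [codegree_comm i k, G.adj_comm i k, eq_comm (a := i)]

lemma codegree_pos_iff {i k : V} : codegree G i k ≠ 0 ↔ ∃ j, G.Adj i j ∧ G.Adj k j := by
  classical
  rw [codegree, Finset.card_ne_zero]
  constructor
  · rintro ⟨j, hj⟩
    exact ⟨j, by simpa using hj⟩
  · rintro ⟨j, hj⟩
    exact ⟨j, by simpa using hj⟩

lemma codegree_deleteEdge_of_ne {i k : V} (hiu : i ≠ u) (hiv : i ≠ v) (hku : k ≠ u)
    (hkv : k ≠ v) : codegree (G.deleteEdges {s(u, v)}) i k = codegree G i k := by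
  unfold codegree
  congr 1
  ext j
  simp only [Finset.mem_filter, deleteEdge_adj_iff, hiu, hiv, hku, hkv, false_and,
    not_false_eq_true, and_true]

lemma codegree_deleteEdge_ends :
    codegree (G.deleteEdges {s(u, v)}) u v = codegree G u v := by
  classical
  unfold codegree
  congr 1
  ext j
  simp only [deleteEdge_adj_iff, Finset.mem_filter, Finset.mem_univ, true_and]
  constructor
  · tauto
  · rintro ⟨h1, h2⟩
    have := h1.ne
    have := h2.ne
    tauto

open Classical in
lemma codegree_deleteEdge_left {k : V} (h : G.Adj u v) (hku : k ≠ u) :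
    codegree G u k =
      codegree (G.deleteEdges {s(u, v)}) u k + if G.Adj v k then 1 else 0 := by
  have huv := h.ne
  by_cases hvk : G.Adj v k
  · have hkv := hvk.ne'
    rw [if_pos hvk, codegree, codegree]
    have : ({j : V | G.Adj u j ∧ G.Adj k j} : Finset V) =
        insert v ({j : V | (G.deleteEdges {s(u, v)}).Adj u j ∧
          (G.deleteEdges {s(u, v)}).Adj k j} : Finset V) := by
      ext j
      simp only [deleteEdge_adj_iff, Finset.mem_filter, Finset.mem_univ, true_and,
        Finset.mem_insert]
      by_cases hj : j = v
      · subst hj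
        simp [h, hvk.symm]
      · tauto
    rw [this, Finset.card_insert_of_notMem]
    · congr!
    intro hv
    exact (deleteEdge_adj_iff.1 (Finset.mem_filter.1 hv).2.1).2.1 ⟨rfl, rfl⟩
  · rw [if_neg hvk, add_zero, codegree, codegree]
    congr 1
    ext j
    simp only [deleteEdge_adj_iff, Finset.mem_filter, Finset.mem_univ, true_and]
    constructor
    · rintro ⟨h1, h2⟩
      refine ⟨⟨h1, ?_, by tauto⟩, h2, by tauto, ?_⟩
      · rintro ⟨-, rfl⟩
        exact hvk h2.symm
      · rintro ⟨-, rfl⟩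
        exact h1.ne rfl
    · tauto

open Classical in
/-- A bound for the loss of energy at the pair `(u, k)` when the edge `uv` is deleted; for
`k = v` it is half of the loss. -/
noncomputable def energyLoss {V : Type*} [Fintype V] (G : SimpleGraph V) (u v k : V) : ℤ :=
  if k = v then (if codegree G u v = 0 then 0 else 2)
  else if G.Adj v k ∧ k ≠ u ∧ (G.Adj u k ∨ codegree G u k ≠ 1) then 2 * codegree G u k + 2
  else 0

lemma energyLoss_nonneg (k : V) : 0 ≤ energyLoss G u v k := by
  unfold energyLoss
  split_ifs <;> positivity

lemma pairEnergy_le_deleteEdge_add_left {k : V} (h : G.Adj u v) (hku : k ≠ u) (hkv : k ≠ v) :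
    pairEnergy G u k ≤ pairEnergy (G.deleteEdges {s(u, v)}) u k + energyLoss G u v k := by
  classical
  have hd := codegree_deleteEdge_left h hku
  have hadj : (G.deleteEdges {s(u, v)}).Adj u k ↔ G.Adj u k := by
    rw [deleteEdge_adj_iff]
    tauto
  unfold pairEnergy energyLoss
  rw [hadj, hd]
  generalize codegree (G.deleteEdges {s(u, v)}) u k = d
  by_cases hvk : G.Adj v k
  · by_cases huk : G.Adj u k
    · by_cases d0 : d = 0
      · simp [hvk, huk, hku, hku.symm, hkv, d0]
      · simp only [hvk, huk, hku.symm, hkv, d0, if_true, if_false]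
        simp [hku]
        linarith
    · by_cases d0 : d = 0
      · simp [hvk, huk, hku, hku.symm, hkv, d0]
      · simp only [hvk, huk, hku.symm, hkv, d0, if_true, if_false]
        simp [d0, hku]
        linarith
  · simp [hvk, hkv]

lemma pairEnergy_le_deleteEdge_add_ends (h : G.Adj u v) :
    pairEnergy G u v ≤ pairEnergy (G.deleteEdges {s(u, v)}) u v +
      (energyLoss G u v v + energyLoss G v u u) := by
  unfold pairEnergy energyLoss
  rw [codegree_deleteEdge_ends, codegree_comm v u]
  generalize codegree G u v = d
  by_cases d0 : d = 0
  · simp [d0]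
  · simp [d0, h, h.ne]

open Classical in
lemma pairEnergy_le_deleteEdge_add (h : G.Adj u v) (i k : V) :
    pairEnergy G i k ≤ pairEnergy (G.deleteEdges {s(u, v)}) i k +
      ((if i = u then energyLoss G u v k else 0) + (if k = u then energyLoss G u v i else 0) +
      ((if i = v then energyLoss G v u k else 0) +
        (if k = v then energyLoss G v u i else 0))) := by
  have hne := h.ne
  have hnn : ∀ a b c, 0 ≤ energyLoss G a b c := fun a b c => energyLoss_nonneg c
  have left : ∀ k, k ≠ u → k ≠ v → pairEnergy G u k ≤
      pairEnergy (G.deleteEdges {s(u, v)}) u k + energyLoss G u v k :=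
    fun k => pairEnergy_le_deleteEdge_add_left h
  have right : ∀ k, k ≠ u → k ≠ v → pairEnergy G v k ≤
      pairEnergy (G.deleteEdges {s(u, v)}) v k + energyLoss G v u k := by
    intro k h1 h2
    have := pairEnergy_le_deleteEdge_add_left h.symm h2 h1
    rwa [Sym2.eq_swap] at this
  have ends := pairEnergy_le_deleteEdge_add_ends h
  by_cases hik : i = k
  · subst hik
    have e : ∀ H : SimpleGraph V, pairEnergy H i i = 0 := fun H => by simp [pairEnergy]
    rw [e, e]
    have h1 := hnn u v i
    have h2 := hnn v u i
    split_ifs <;> linarith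
  by_cases hiu : i = u
  · subst hiu
    by_cases hkv : k = v
    · subst hkv
      simpa [hne, hne.symm] using ends
    · simpa [hne, hkv, Ne.symm hik] using left k (Ne.symm hik) hkv
  by_cases hiv : i = v
  · subst hiv
    by_cases hku : k = u
    · subst hku
      rw [pairEnergy_comm i k, pairEnergy_comm i k]
      simpa [hne, hne.symm, add_comm] using ends
    · simpa [hne.symm, hku, Ne.symm hik] using right k hku (Ne.symm hik)
  by_cases hku : k = u
  · subst hku
    rw [pairEnergy_comm i k, pairEnergy_comm i k]
    simpa [hne, hiu, hiv] using left i hiu hiv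
  by_cases hkv : k = v
  · subst hkv
    rw [pairEnergy_comm i k, pairEnergy_comm i k]
    simpa [hne.symm, hiu, hiv] using right i hiu hiv
  simp [pairEnergy, codegree_deleteEdge_of_ne hiu hiv hku hkv, hiu, hiv, hku, hkv]

/-- The sum of the contributions of all ordered pairs of vertices. -/
noncomputable def energy {V : Type*} [Fintype V] (G : SimpleGraph V) : ℤ :=
  ∑ i, ∑ k, pairEnergy G i k

lemma energy_le_deleteEdge_add (h : G.Adj u v) :
    energy G ≤ energy (G.deleteEdges {s(u, v)}) +
      2 * (∑ k, energyLoss G u v k + ∑ k, energyLoss G v u k) := by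
  classical
  have := Finset.sum_le_sum fun i (_ : i ∈ Finset.univ) =>
    Finset.sum_le_sum fun k (_ : k ∈ Finset.univ) => pairEnergy_le_deleteEdge_add h i k
  refine this.trans (le_of_eq ?_)
  have e : ∀ (a : V) (f : V → ℤ), ∑ i, ∑ k, (if i = a then f k else 0) = ∑ k, f k := by
    intro a f
    rw [Finset.sum_comm]
    simp
  simp only [Finset.sum_add_distrib, e, Finset.sum_ite_eq', Finset.mem_univ, if_true]
  unfold energy
  ring

lemma energyLoss_eq_zero_of_not_reachable (h : G.Adj u v)
    (hr : ¬ (G.deleteEdges {s(u, v)}).Reachable u v)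
    (k : V) : energyLoss G u v k = 0 := by
  classical
  have hco : codegree G u v = 0 := by
    rw [← codegree_deleteEdge_ends]
    by_contra h0
    obtain ⟨j, h1, h2⟩ := codegree_pos_iff.1 h0
    exact hr (h1.reachable.trans h2.symm.reachable)
  unfold energyLoss
  split_ifs with h1 h2
  · rfl
  · exfalso
    obtain ⟨hvk, hku, h3⟩ := h2
    have hvk' : (G.deleteEdges {s(u, v)}).Adj v k := by
      rw [deleteEdge_adj_iff]
      tauto
    apply hr
    rcases h3 with h3 | h3
    · have : (G.deleteEdges {s(u, v)}).Adj u k := by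
        rw [deleteEdge_adj_iff]
        tauto
      exact this.reachable.trans hvk'.symm.reachable
    · have hd := codegree_deleteEdge_left h hku
      rw [if_pos hvk] at hd
      obtain ⟨j, h4, h5⟩ := codegree_pos_iff.1
        (show codegree (G.deleteEdges {s(u, v)}) u k ≠ 0 by omega)
      exact h4.reachable.trans (h5.symm.reachable.trans hvk'.symm.reachable)
  · rfl

open Classical in
lemma sum_adj_eq_degree (x : V) (c : ℤ) :
    ∑ k, (if G.Adj x k then c else 0) = G.degree x * c := by
  rw [← Finset.sum_filter, Finset.sum_const, nsmul_eq_mul, ← G.card_neighborFinset_eq_degree]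
  congr 3
  ext k
  simp

open Classical in
lemma codegree_le_degree_right (i k : V) : codegree G i k ≤ G.degree k := by
  rw [← G.card_neighborFinset_eq_degree]
  refine Finset.card_le_card fun j hj => ?_
  rw [Finset.mem_filter] at hj
  rw [mem_neighborFinset]
  exact hj.2.2

open Classical in
lemma codegree_lt_degree_right {i k : V} (h : G.Adj i k) : codegree G i k < G.degree k := by
  rw [← G.card_neighborFinset_eq_degree]
  refine Finset.card_lt_card ⟨fun j hj => ?_, fun hs => ?_⟩
  · rw [Finset.mem_filter] at hj
    rw [mem_neighborFinset]
    exact hj.2.2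
  · have := hs ((G.mem_neighborFinset k i).2 h.symm)
    rw [Finset.mem_filter] at this
    exact this.2.1.ne rfl

lemma energyLoss_end_le : energyLoss G u v v ≤ 2 := by
  unfold energyLoss
  rw [if_pos rfl]
  split_ifs <;> norm_num

open Classical in
lemma energyLoss_le {k : V} (hkv : k ≠ v) :
    energyLoss G u v k ≤ if G.Adj v k ∧ k ≠ u then 2 * (codegree G u k : ℤ) + 2 else 0 := by
  unfold energyLoss
  rw [if_neg hkv]
  split_ifs <;> tauto

open Classical in
lemma energyLoss_add_le_of_three_le_degree {x : V} (hxu : x ≠ u) (hxv : x ≠ v)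
    (hx : G.degree x = 0 ∨ 3 ≤ G.degree x) :
    energyLoss G u v x + energyLoss G v u x ≤
      4 * (if G.degree x = 0 then (0 : ℤ) else G.degree x - 2) +
        (if G.Adj v x then 4 else 0) + (if G.Adj u x then 4 else 0) := by
  have h1 := energyLoss_le (G := G) (u := u) hxv
  have h2 := energyLoss_le (G := G) (u := v) hxu
  have hu := codegree_le_degree_right (G := G) u x
  have hv := codegree_le_degree_right (G := G) v x
  have hpos : ∀ {w}, G.Adj w x → G.degree x ≠ 0 := fun {w} hw =>
    ((G.degree_pos_iff_exists_adj x).2 ⟨w, hw.symm⟩).ne'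
  by_cases hvx : G.Adj v x <;> by_cases hux : G.Adj u x
  · have hu := codegree_lt_degree_right hux
    have hv := codegree_lt_degree_right hvx
    have h0 := hpos hvx
    simp only [hvx, hux, hxu, hxv, h0, ne_eq, not_false_eq_true, and_self, if_true,
      if_false] at h1 h2 ⊢
    omega
  · have h0 := hpos hvx
    simp only [hvx, hux, hxu, h0, ne_eq, not_false_eq_true, and_self, if_true,
      if_false, false_and] at h1 h2 ⊢
    omega
  · have h0 := hpos hux
    simp only [hvx, hux, hxv, h0, ne_eq, not_false_eq_true, and_self, if_true,
      if_false, false_and] at h1 h2 ⊢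
    omega
  · simp only [hvx, hux, if_false, false_and] at h1 h2 ⊢
    split_ifs <;> omega

open Classical in
lemma sum_energyLoss_le_of_three_le_degree (h : G.Adj u v)
    (hG : ∀ x, G.degree x = 0 ∨ 3 ≤ G.degree x) :
    ∑ k, energyLoss G u v k + ∑ k, energyLoss G v u k ≤
      12 + 4 * ∑ x, (if G.degree x = 0 then (0 : ℤ) else G.degree x - 2) := by
  have hu0 : G.degree u ≠ 0 := ((G.degree_pos_iff_exists_adj u).2 ⟨v, h⟩).ne'
  have hv0 : G.degree v ≠ 0 := ((G.degree_pos_iff_exists_adj v).2 ⟨u, h.symm⟩).ne'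
  have loss_self : ∀ {a b : V}, a ≠ b → energyLoss G a b a = 0 := by
    intro a b hab
    simp [energyLoss, hab]
  have hpt : ∀ x, energyLoss G u v x + energyLoss G v u x ≤
      4 * (if G.degree x = 0 then (0 : ℤ) else G.degree x - 2) +
        (if G.Adj v x then 4 else 0) + (if G.Adj u x then 4 else 0) +
        (if x = u then 6 - 4 * (G.degree u : ℤ) else 0) +
        (if x = v then 6 - 4 * (G.degree v : ℤ) else 0) := by
    intro x
    by_cases hxu : x = u
    · subst hxu
      rw [loss_self h.ne]
      have := energyLoss_end_le (G := G) (u := v) (v := x)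
      simp only [hu0, h.symm, h.ne, if_true, if_false, SimpleGraph.irrefl]
      linarith
    by_cases hxv : x = v
    · subst hxv
      rw [loss_self h.ne']
      have := energyLoss_end_le (G := G) (u := u) (v := x)
      simp only [hv0, h, h.ne', if_true, if_false, SimpleGraph.irrefl]
      linarith
    simpa only [hxu, hxv, if_false, add_zero] using
      energyLoss_add_le_of_three_le_degree hxu hxv (hG x)
  rw [← Finset.sum_add_distrib]
  refine (Finset.sum_le_sum fun x _ => hpt x).trans (le_of_eq ?_)
  simp only [Finset.sum_add_distrib, ← Finset.mul_sum, sum_adj_eq_degree, Finset.sum_ite_eq',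
    Finset.mem_univ, if_true]
  ring

open Classical in
lemma sum_energyLoss_le_of_degree_eq_two (h : G.Adj u v) (hu : G.degree u = 2)
    (hG : ∀ x, G.degree x = 0 ∨ 2 ≤ G.degree x) :
    ∑ k, energyLoss G u v k + ∑ k, energyLoss G v u k ≤
      12 + 4 * ∑ x, (if G.degree x = 0 then (0 : ℤ) else G.degree x - 2) := by
  obtain ⟨a, hav, hN⟩ : ∃ a, a ≠ v ∧ ∀ x, G.Adj u x ↔ x = v ∨ x = a := by
    rw [← G.card_neighborFinset_eq_degree, Finset.card_eq_two] at hu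
    obtain ⟨x, y, hxy, hs⟩ := hu
    have hN : ∀ z, G.Adj u z ↔ z = x ∨ z = y := by
      intro z
      rw [← mem_neighborFinset, hs]
      simp
    rcases (hN v).1 h with rfl | rfl
    · exact ⟨y, hxy.symm, hN⟩
    · exact ⟨x, hxy, fun z => (hN z).trans or_comm⟩
  have hua : G.Adj u a := (hN a).2 (Or.inr rfl)
  have hv0 : G.degree v ≠ 0 := ((G.degree_pos_iff_exists_adj v).2 ⟨u, h.symm⟩).ne'
  have ha0 : G.degree a ≠ 0 := ((G.degree_pos_iff_exists_adj a).2 ⟨u, hua.symm⟩).ne'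
  have hsum : (G.degree v : ℤ) - 2 + (G.degree a - 2) ≤
      ∑ x, (if G.degree x = 0 then (0 : ℤ) else G.degree x - 2) := by
    have := Finset.sum_le_sum_of_subset_of_nonneg (Finset.subset_univ {v, a})
      (f := fun x => if G.degree x = 0 then (0 : ℤ) else G.degree x - 2) (by
        intro x _ _
        have := hG x
        split_ifs <;> omega)
    rw [Finset.sum_pair hav.symm] at this
    simpa [hv0, ha0] using this
  have hco : ∀ k, codegree G u k = (if G.Adj v k then 1 else 0) + if G.Adj a k then 1 else 0 := by
    intro k
    have : ({j : V | G.Adj u j ∧ G.Adj k j} : Finset V) = ({v, a} : Finset V).filter (G.Adj k) := by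
      ext j
      simp [hN]
    rw [codegree, this, Finset.card_filter, Finset.sum_pair hav.symm, G.adj_comm v, G.adj_comm a]
  have hfirst : ∑ k, energyLoss G u v k ≤
      (if G.Adj v a then 2 else 0) + 4 * (G.degree v - 1) + 2 * (codegree G v a - 1) := by
    have hpt : ∀ k, energyLoss G u v k ≤
        (if k = v then (if G.Adj v a then 2 else 0) else 0) +
        (if k = u then -6 else 0) +
        (if G.Adj v k then 4 else 0) + 2 * (if G.Adj v k ∧ G.Adj a k then 1 else 0) := by
      intro k
      by_cases hkv : k = v
      · subst hkv
        unfold energyLoss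
        rw [hco]
        simp [G.adj_comm a k, h.ne']
      · refine (energyLoss_le hkv).trans ?_
        rw [hco]
        by_cases hku : k = u
        · subst hku
          simp [h.symm, hua.symm, hkv]
        · by_cases h1 : G.Adj v k <;> by_cases h2 : G.Adj a k <;> simp [h1, h2, hku, hkv]
    refine (Finset.sum_le_sum fun k _ => hpt k).trans (le_of_eq ?_)
    simp only [Finset.sum_add_distrib, ← Finset.mul_sum, sum_adj_eq_degree, Finset.sum_ite_eq',
      Finset.mem_univ, if_true, Finset.sum_boole]
    rw [codegree]
    ring
  have hsecond : ∑ k, energyLoss G v u k ≤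
      (if G.Adj v a then 2 else 0) + (2 * codegree G v a + 2) := by
    have hpt : ∀ k, energyLoss G v u k ≤
        (if k = u then (if G.Adj v a then 2 else 0) else 0) +
        (if k = a then 2 * (codegree G v a : ℤ) + 2 else 0) := by
      intro k
      by_cases hku : k = u
      · subst hku
        unfold energyLoss
        rw [codegree_comm, hco]
        simp [G.adj_comm a v, hua.ne]
      · refine (energyLoss_le hku).trans ?_
        rw [if_neg hku, zero_add]
        by_cases hka : k = a
        · subst hka
          simp [hua, hav]
        · rw [if_neg, if_neg hka]
          rw [hN]
          tauto
    refine (Finset.sum_le_sum fun k _ => hpt k).trans (le_of_eq ?_)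
    simp only [Finset.sum_add_distrib, Finset.sum_ite_eq', Finset.mem_univ, if_true]
  have hle := codegree_le_degree_right (G := G) v a
  by_cases hva : G.Adj v a
  · have hlt := codegree_lt_degree_right hva
    simp only [hva, if_true] at hfirst hsecond
    linarith [(show (codegree G v a : ℤ) + 1 ≤ G.degree a by exact_mod_cast hlt)]
  · simp only [hva, if_false] at hfirst hsecond
    linarith [(show (codegree G v a : ℤ) ≤ G.degree a by exact_mod_cast hle)]

lemma exists_edge_sum_energyLoss_le (hne : ∃ a b, G.Adj a b)
    (hG : ∀ a b, G.Adj a b → (G.deleteEdges {s(a, b)}).Reachable a b) :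
    ∃ a b, G.Adj a b ∧ ∑ k, energyLoss G a b k + ∑ k, energyLoss G b a k ≤
      4 * (2 * cyc G + 1) := by
  classical
  have hdeg : ∀ x, G.degree x = 0 ∨ 2 ≤ G.degree x := by
    intro x
    by_contra hx
    have hx1 : G.degree x = 1 := by omega
    obtain ⟨y, hxy, hy⟩ := degree_eq_one_iff_existsUnique_adj.1 hx1
    refine hxy.ne (reachable_eq_of_isolated (fun z hz => ?_) (hG x y hxy))
    rw [deleteEdge_adj_iff] at hz
    exact hz.2.1 ⟨rfl, hy z hz.1⟩
  by_cases h2 : ∃ u, G.degree u = 2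
  · obtain ⟨u, hu⟩ := h2
    obtain ⟨v, h⟩ := (G.degree_pos_iff_exists_adj u).1 (by omega)
    refine ⟨u, v, h, ?_⟩
    linarith [sum_energyLoss_le_of_degree_eq_two h hu hdeg, two_add_sum_degree_sub_two_le_cyc h]
  · obtain ⟨u, v, h⟩ := hne
    refine ⟨u, v, h, ?_⟩
    have hdeg' : ∀ x, G.degree x = 0 ∨ 3 ≤ G.degree x := by
      intro x
      have := hdeg x
      have : G.degree x ≠ 2 := fun hx => h2 ⟨x, hx⟩
      omega
    linarith [sum_energyLoss_le_of_three_le_degree h hdeg', two_add_sum_degree_sub_two_le_cyc h]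

end CodegreeEnergy

lemma cyc_nonneg_and_energy_le {V : Type*} [Fintype V] (G : SimpleGraph V) :
    0 ≤ cyc G ∧ energy G ≤ 8 * cyc G * (cyc G + 2) := by
  classical
  induction hn : G.edgeSet.ncard generalizing G with
  | zero =>
    have hbot : G = ⊥ := by
      rw [Set.ncard_eq_zero (Set.toFinite _)] at hn
      exact edgeSet_eq_empty.1 hn
    have hcyc : 0 ≤ cyc G := by
      have : Function.Injective G.connectedComponentMk := by
        intro x y hxy
        exact reachable_eq_of_isolated (by simp [hbot]) (ConnectedComponent.exact hxy)
      have := Nat.card_le_card_of_injective _ this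
      unfold cyc
      omega
    have hen : energy G = 0 := by
      refine Finset.sum_eq_zero fun i _ => Finset.sum_eq_zero fun k _ => ?_
      simp [pairEnergy, codegree, hbot]
    exact ⟨hcyc, by rw [hen]; positivity⟩
  | succ n ih =>
    have hcard : ∀ {u v : V}, G.Adj u v → (G.deleteEdges {s(u, v)}).edgeSet.ncard = n := by
      intro u v h
      have := ncard_edgeSet_deleteEdge h
      omega
    by_cases hb : ∃ u v, G.Adj u v ∧ ¬ (G.deleteEdges {s(u, v)}).Reachable u v
    · obtain ⟨u, v, h, hr⟩ := hb
      obtain ⟨h1, h2⟩ := ih _ (hcard h)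
      have h3 := cyc_deleteEdge_le h
      have h4 := energy_le_deleteEdge_add h
      have hr' : ¬ (G.deleteEdges {s(v, u)}).Reachable v u := by
        rw [Sym2.eq_swap]
        exact fun h => hr h.symm
      simp only [energyLoss_eq_zero_of_not_reachable h hr,
        energyLoss_eq_zero_of_not_reachable h.symm hr', Finset.sum_const_zero] at h4
      refine ⟨h1.trans h3, ?_⟩
      nlinarith
    · push Not at hb
      have hne : ∃ a b, G.Adj a b := by
        by_contra! h0
        have : G.edgeSet = ∅ := edgeSet_eq_empty.2 (by ext a b; simpa using h0 a b)
        simp [this] at hn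
      obtain ⟨u, v, h, hloss⟩ := exists_edge_sum_energyLoss_le hne hb
      obtain ⟨h1, h2⟩ := ih _ (hcard h)
      have h3 := cyc_deleteEdge_of_reachable h (hb u v h)
      have h4 := energy_le_deleteEdge_add h
      rw [h3] at h1 h2
      exact ⟨by linarith, by nlinarith⟩

section BadPairs

open Classical in
/-- The middle vertices `j` of the bad directed paths `i → j → k`. -/
noncomputable def badMiddles {V : Type*} [Fintype V] (G : SimpleGraph V)
    (elt : Sym2 V → Sym2 V → Prop) (i k : V) : Finset V :=
  {j : V | G.Adj i j ∧ G.Adj k j ∧ (G.Adj i k ∨ ∃ l, G.Adj i l ∧ G.Adj k l ∧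
    (∃ e ∈ [s(i, j), s(j, k), s(k, l), s(l, i)], elt e s(i, j)) ∧
    (∃ e ∈ [s(i, j), s(j, k), s(k, l), s(l, i)], elt e s(j, k)))}

open Classical in
/-- The directed 4-cycles `i → j → k → l → i`, encoded as `⟨(i, k), (j, l)⟩`. -/
noncomputable def squares {V : Type*} [Fintype V] (G : SimpleGraph V) :
    Finset (Σ _ : V × V, V × V) :=
  (Finset.univ : Finset V).offDiag.sigma fun p =>
    ({j : V | G.Adj p.1 j ∧ G.Adj p.2 j} : Finset V).offDiag

/-- The closing arc `l → i` of a directed 4-cycle underlies its minimal edge. -/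
def ClosingArcMinimal {V : Type*} (elt : Sym2 V → Sym2 V → Prop)
    (x : Σ _ : V × V, V × V) : Prop :=
  elt s(x.2.2, x.1.1) s(x.1.1, x.2.1) ∧ elt s(x.2.2, x.1.1) s(x.2.1, x.1.2) ∧
    elt s(x.2.2, x.1.1) s(x.1.2, x.2.2)

variable {V : Type*} [Fintype V] {G : SimpleGraph V} {elt : Sym2 V → Sym2 V → Prop}

lemma mem_badMiddles {i j k : V} : j ∈ badMiddles G elt i k ↔
    G.Adj i j ∧ G.Adj k j ∧ (G.Adj i k ∨ ∃ l, G.Adj i l ∧ G.Adj k l ∧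
    (∃ e ∈ [s(i, j), s(j, k), s(k, l), s(l, i)], elt e s(i, j)) ∧
    (∃ e ∈ [s(i, j), s(j, k), s(k, l), s(l, i)], elt e s(j, k))) := by
  simp only [badMiddles, Finset.mem_filter, Finset.mem_univ, true_and]

lemma mem_squares {i j k l : V} : (⟨(i, k), (j, l)⟩ : Σ _ : V × V, V × V) ∈ squares G ↔
    i ≠ k ∧ j ≠ l ∧ G.Adj i j ∧ G.Adj j k ∧ G.Adj k l ∧ G.Adj l i := by
  simp only [squares, Finset.mem_sigma, Finset.mem_offDiag, Finset.mem_filter, Finset.mem_univ,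
    true_and, G.adj_comm k j, G.adj_comm i l]
  tauto

lemma card_badMiddles_le (i k : V) : #(badMiddles G elt i k) ≤ codegree G i k := by
  classical
  refine Finset.card_le_card fun j hj => ?_
  rw [mem_badMiddles] at hj
  simp [hj.1, hj.2.1]

lemma card_badMiddles_lt (hord : IsStrictTotalOrder (Sym2 V) elt) {i k : V}
    (hik : ¬ G.Adj i k) (h0 : codegree G i k ≠ 0) :
    #(badMiddles G elt i k) < codegree G i k := by
  classical
  obtain ⟨j₀, hj₀⟩ := codegree_pos_iff.1 h0
  have wf : WellFounded elt := Finite.wellFounded_of_trans_of_irrefl elt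
  obtain ⟨m, ⟨j, hij, hkj, hm⟩, hmin⟩ := wf.has_min
    {e | ∃ j, G.Adj i j ∧ G.Adj k j ∧ (e = s(i, j) ∨ e = s(j, k))}
    ⟨_, j₀, hj₀.1, hj₀.2, Or.inl rfl⟩
  refine Finset.card_lt_card ⟨fun j hj => ?_, fun hs => ?_⟩
  · rw [mem_badMiddles] at hj
    simp [hj.1, hj.2.1]
  · have hj := hs (show j ∈ _ by simp [hij, hkj])
    rw [mem_badMiddles] at hj
    obtain ⟨-, -, hj | ⟨l, hil, hkl, ⟨e, he, hlt⟩, e', he', hlt'⟩⟩ := hj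
    · exact hik hj
    · have hmem : ∀ e ∈ [s(i, j), s(j, k), s(k, l), s(l, i)], ¬ elt e m := by
        intro e he
        simp only [List.mem_cons, List.not_mem_nil, or_false] at he
        rcases he with rfl | rfl | rfl | rfl
        · exact hmin _ ⟨j, hij, hkj, Or.inl rfl⟩
        · exact hmin _ ⟨j, hij, hkj, Or.inr rfl⟩
        · exact hmin _ ⟨l, hil, hkl, Or.inr Sym2.eq_swap⟩
        · exact hmin _ ⟨l, hil, hkl, Or.inl Sym2.eq_swap⟩
      rcases hm with rfl | rfl
      · exact hmem e he hlt
      · exact hmem e' he' hlt'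

lemma four_mul_card_closingArcMinimal_le [DecidablePred (ClosingArcMinimal elt)]
    (hord : IsStrictTotalOrder (Sym2 V) elt) :
    4 * #((squares G).filter (ClosingArcMinimal elt)) ≤ #(squares G) := by
  let ρ : (Σ _ : V × V, V × V) ≃ (Σ _ : V × V, V × V) :=
    { toFun := fun x => ⟨(x.2.1, x.2.2), (x.1.2, x.1.1)⟩
      invFun := fun x => ⟨(x.2.2, x.2.1), (x.1.1, x.1.2)⟩
      left_inv := fun _ => rfl
      right_inv := fun _ => rfl }
  have hρ : ∀ x, x ∈ squares G ↔ ρ x ∈ squares G := by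
    rintro ⟨⟨i, k⟩, j, l⟩
    simp only [ρ, Equiv.coe_fn_mk, mem_squares]
    have := ne_comm (a := i) (b := k)
    tauto
  let f : (Σ _ : V × V, V × V) → ℕ := fun x => if ClosingArcMinimal elt x then 1 else 0
  have hf : ∀ g : (Σ _ : V × V, V × V) → ℕ,
      ∑ x ∈ squares G, g (ρ x) = ∑ x ∈ squares G, g x :=
    fun g => Finset.sum_equiv ρ hρ fun _ _ => rfl
  have h1 : ∑ x ∈ squares G, (f x + f (ρ x) + f (ρ (ρ x)) + f (ρ (ρ (ρ x)))) ≤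
      ∑ x ∈ squares G, 1 := by
    refine Finset.sum_le_sum ?_
    rintro ⟨⟨i, k⟩, j, l⟩ -
    have hasymm : ∀ {a b : Sym2 V}, elt a b → ¬ elt b a := fun h h' =>
      hord.toIsStrictOrder.irrefl _ (hord.toIsStrictOrder.trans _ _ _ h h')
    dsimp only [f, ρ, Equiv.coe_fn_mk]
    split_ifs with h1 h2 h3 h4 h5 h6 h7 h8 <;>
      first
      | omega
      | (exfalso
         simp only [ClosingArcMinimal] at *
         tauto)
  simp only [Finset.sum_add_distrib, hf fun x => f (ρ (ρ x)), hf fun x => f (ρ x), hf f] at h1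
  have h2 : ∑ x ∈ squares G, f x = #((squares G).filter (ClosingArcMinimal elt)) :=
    (Finset.card_filter _ _).symm
  have h3 : ∑ x ∈ squares G, 1 = #(squares G) := by simp
  omega

lemma card_add_card_squares_le_energy (hord : IsStrictTotalOrder (Sym2 V) elt) :
    4 * (#((Finset.univ : Finset V).offDiag.sigma fun p => badMiddles G elt p.1 p.2) : ℤ) +
      #(squares G) ≤ energy G := by
  have henergy : energy G = ∑ p ∈ (Finset.univ : Finset V).offDiag, pairEnergy G p.1 p.2 := by
    unfold energy
    rw [← Fintype.sum_prod_type']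
    refine (Finset.sum_subset (Finset.subset_univ _) fun p _ hp => ?_).symm
    have : p.1 = p.2 := by simpa using hp
    simp [pairEnergy, this]
  rw [henergy, squares, Finset.card_sigma, Finset.card_sigma]
  push_cast
  rw [Finset.mul_sum, ← Finset.sum_add_distrib]
  refine Finset.sum_le_sum ?_
  rintro ⟨i, k⟩ hik
  have hik : i ≠ k := by simpa using hik
  have hle := card_badMiddles_le (G := G) (elt := elt) i k
  rw [Finset.offDiag_card, Nat.cast_sub (Nat.le_mul_self _)]
  change 4 * (#(badMiddles G elt i k) : ℤ) +
    (((codegree G i k * codegree G i k : ℕ) : ℤ) - codegree G i k) ≤ pairEnergy G i k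
  unfold pairEnergy
  by_cases h0 : codegree G i k = 0
  · have : #(badMiddles G elt i k) = 0 := by omega
    simp [h0, this]
  · have hle' : (#(badMiddles G elt i k) : ℤ) ≤ codegree G i k := by exact_mod_cast hle
    by_cases hadj : G.Adj i k
    · simp only [hik, h0, hadj, or_self, if_true, if_false]
      push_cast
      nlinarith
    · have hlt : (#(badMiddles G elt i k) : ℤ) + 1 ≤ codegree G i k := by
        exact_mod_cast card_badMiddles_lt hord hadj h0
      simp only [hik, h0, hadj, or_self, if_false]
      push_cast
      nlinarith

/-- The pair of arcs `i → j`, `j → k` with `j ∈ badMiddles G elt i k`. -/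
def IsBadPath (G : SimpleGraph V) (elt : Sym2 V → Sym2 V → Prop) (z : Sym2 (V × V)) : Prop :=
  ∃ i j k, i ≠ k ∧ j ∈ badMiddles G elt i k ∧ z = s((i, j), (j, k))

/-- The pair of arcs `i → j`, `k → l` of a directed 4-cycle `i → j → k → l → i` whose arc
`l → i` underlies the minimal edge. -/
def IsBadOpposite (G : SimpleGraph V) (elt : Sym2 V → Sym2 V → Prop) (z : Sym2 (V × V)) :
    Prop :=
  ∃ i j k l, (⟨(i, k), (j, l)⟩ : Σ _ : V × V, V × V) ∈ squares G ∧
    ClosingArcMinimal elt ⟨(i, k), (j, l)⟩ ∧ z = s((i, j), (k, l))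

lemma isBadPath_of_triangle {x y z : V} (hxy : G.Adj x y) (hyz : G.Adj y z) (hzx : G.Adj z x) :
    IsBadPath G elt s((x, y), (y, z)) :=
  ⟨x, y, z, hzx.ne', mem_badMiddles.2 ⟨hxy, hyz.symm, Or.inl hzx.symm⟩, rfl⟩

lemma isBadPath_of_square {x y z t : V} (hxz : x ≠ z) (hxy : G.Adj x y) (hyz : G.Adj y z)
    (hzt : G.Adj z t) (htx : G.Adj t x)
    (h1 : ∃ e ∈ [s(x, y), s(y, z), s(z, t), s(t, x)], elt e s(x, y))
    (h2 : ∃ e ∈ [s(x, y), s(y, z), s(z, t), s(t, x)], elt e s(y, z)) :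
    IsBadPath G elt s((x, y), (y, z)) :=
  ⟨x, y, z, hxz, mem_badMiddles.2 ⟨hxy, hyz.symm, Or.inr ⟨t, htx.symm, hzt, h1, h2⟩⟩, rfl⟩

lemma isBadOpposite_of_square (hord : IsStrictTotalOrder (Sym2 V) elt) {x y z t : V}
    (hxz : x ≠ z) (hyt : y ≠ t) (hxy : G.Adj x y) (hyz : G.Adj y z)
    (hzt : G.Adj z t) (htx : G.Adj t x)
    (h1 : ∃ e ∈ [s(x, y), s(y, z), s(z, t), s(t, x)], elt e s(x, y))
    (h2 : ∃ e ∈ [s(x, y), s(y, z), s(z, t), s(t, x)], elt e s(z, t)) :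
    IsBadOpposite G elt s((x, y), (z, t)) := by
  have wf : WellFounded elt := Finite.wellFounded_of_trans_of_irrefl elt
  obtain ⟨m, hm, hmin⟩ := wf.has_min {e | e ∈ [s(x, y), s(y, z), s(z, t), s(t, x)]}
    ⟨s(x, y), by simp⟩
  have hlt : ∀ e ∈ [s(x, y), s(y, z), s(z, t), s(t, x)], m ≠ e → elt m e := by
    intro e he hne
    by_contra hme
    exact hne (hord.toTrichotomous.trichotomous _ _ hme (hmin e he))
  have hxyne := hxy.ne
  have hyzne := hyz.ne
  have hztne := hzt.ne
  have htxne := htx.ne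
  simp only [Set.mem_ofPred_eq, List.mem_cons, List.not_mem_nil, or_false] at hm
  rcases hm with rfl | rfl | rfl | rfl
  · obtain ⟨e, he, h⟩ := h1
    exact absurd h (hmin e he)
  · refine ⟨z, t, x, y, mem_squares.2 ⟨hxz.symm, hyt.symm, hzt, htx, hxy, hyz⟩,
      ⟨hlt _ (by simp) ?_, hlt _ (by simp) ?_, hlt _ (by simp) ?_⟩, Sym2.eq_swap⟩ <;>
    · rw [Ne, Sym2.eq_iff]
      tauto
  · obtain ⟨e, he, h⟩ := h2
    exact absurd h (hmin e he)
  · refine ⟨x, y, z, t, mem_squares.2 ⟨hxz, hyt, hxy, hyz, hzt, htx⟩,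
      ⟨hlt _ (by simp) ?_, hlt _ (by simp) ?_, hlt _ (by simp) ?_⟩, rfl⟩ <;>
    · rw [Ne, Sym2.eq_iff]
      tauto

lemma isBadPath_of_dartsInCycle_three {a b : G.Dart} (hab : a.edge ≠ b.edge)
    (h : dartsInCycle G a b 3) : IsBadPath G elt s(a.toProd, b.toProd) := by
  obtain ⟨x, w, -, hl, ha, hb⟩ := h
  match w, hl with
  | .cons (v := y) hxy (.cons (v := z) hyz (.cons hzx .nil)), _ =>
  have h1 := isBadPath_of_triangle (elt := elt) hxy hyz hzx
  have h2 := isBadPath_of_triangle (elt := elt) hyz hzx hxy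
  have h3 := isBadPath_of_triangle (elt := elt) hzx hxy hyz
  simp only [Walk.darts_cons, Walk.darts_nil, List.mem_cons, List.not_mem_nil, or_false] at ha hb
  rcases ha with rfl | rfl | rfl <;> rcases hb with rfl | rfl | rfl <;>
    first
    | exact absurd rfl hab
    | assumption
    | (rw [Sym2.eq_swap]; assumption)

lemma BadPair.isBadPath_or_isBadOpposite (hord : IsStrictTotalOrder (Sym2 V) elt)
    {a b : G.Dart} (h : BadPair G elt a b) :
    IsBadPath G elt s(a.toProd, b.toProd) ∨ IsBadOpposite G elt s(a.toProd, b.toProd) := by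
  obtain ⟨hab, h | ⟨x, w, hw, hl, ha, hb, ha', hb'⟩⟩ := h
  · exact Or.inl (isBadPath_of_dartsInCycle_three hab h)
  match w, hl with
  | .cons (v := y) hxy (.cons (v := z) hyz (.cons (v := t) hzt (.cons htx .nil))), _ =>
  have hnd := hw.support_nodup
  simp only [Walk.support_cons, Walk.support_nil, List.tail_cons, List.nodup_cons,
    List.mem_cons, List.not_mem_nil, or_false, not_or] at hnd
  have hyt : y ≠ t := hnd.1.2.1
  have hzx : z ≠ x := hnd.2.1.2
  simp only [Walk.edges_cons, Walk.edges_nil] at ha' hb'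
  simp only [Walk.darts_cons, Walk.darts_nil, List.mem_cons, List.not_mem_nil, or_false] at ha hb
  have rot : ∀ {e₁ e₂ e₃ e₄ f : Sym2 V}, (∃ e ∈ [e₁, e₂, e₃, e₄], elt e f) →
      ∃ e ∈ [e₂, e₃, e₄, e₁], elt e f := by
    rintro e₁ e₂ e₃ e₄ f ⟨e, he, h⟩
    refine ⟨e, ?_, h⟩
    simp only [List.mem_cons, List.not_mem_nil, or_false] at he ⊢
    tauto
  rcases ha with rfl | rfl | rfl | rfl <;> rcases hb with rfl | rfl | rfl | rfl
  · exact absurd rfl hab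
  · exact Or.inl (isBadPath_of_square hzx.symm hxy hyz hzt htx ha' hb')
  · exact Or.inr (isBadOpposite_of_square hord hzx.symm hyt hxy hyz hzt htx ha' hb')
  · rw [Sym2.eq_swap]
    exact Or.inl (isBadPath_of_square hyt.symm htx hxy hyz hzt
      (rot (rot (rot hb'))) (rot (rot (rot ha'))))
  · rw [Sym2.eq_swap]
    exact Or.inl (isBadPath_of_square hzx.symm hxy hyz hzt htx hb' ha')
  · exact absurd rfl hab
  · exact Or.inl (isBadPath_of_square hyt hyz hzt htx hxy (rot ha') (rot hb'))
  · exact Or.inr (isBadOpposite_of_square hord hyt hzx hyz hzt htx hxy (rot ha') (rot hb'))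
  · rw [Sym2.eq_swap]
    exact Or.inr (isBadOpposite_of_square hord hzx.symm hyt hxy hyz hzt htx hb' ha')
  · rw [Sym2.eq_swap]
    exact Or.inl (isBadPath_of_square hyt hyz hzt htx hxy (rot hb') (rot ha'))
  · exact absurd rfl hab
  · exact Or.inl (isBadPath_of_square hzx hzt htx hxy hyz (rot (rot ha')) (rot (rot hb')))
  · exact Or.inl (isBadPath_of_square hyt.symm htx hxy hyz hzt
      (rot (rot (rot ha'))) (rot (rot (rot hb'))))
  · rw [Sym2.eq_swap]
    exact Or.inr (isBadOpposite_of_square hord hyt hzx hyz hzt htx hxy (rot hb') (rot ha'))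
  · rw [Sym2.eq_swap]
    exact Or.inl (isBadPath_of_square hzx hzt htx hxy hyz (rot (rot hb')) (rot (rot ha')))
  · exact absurd rfl hab

lemma four_mul_n1_le_energy (hord : IsStrictTotalOrder (Sym2 V) elt) :
    4 * (n1 G elt : ℤ) ≤ energy G := by
  classical
  let S := (Finset.univ : Finset V).offDiag.sigma fun p => badMiddles G elt p.1 p.2
  let T := (squares G).filter (ClosingArcMinimal elt)
  let φ : (Σ _ : V × V, V) → Sym2 (V × V) := fun x => s((x.1.1, x.2), (x.2, x.1.2))
  let ψ : (Σ _ : V × V, V × V) → Sym2 (V × V) := fun x => s((x.1.1, x.2.1), (x.1.2, x.2.2))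
  have hn : n1 G elt ≤ #S + #T := by
    unfold n1
    rw [← Set.ncard_image_of_injective _
      (Sym2.map.injective (Dart.toProd_injective (G := G)))]
    calc _ ≤ (↑(S.image φ ∪ T.image ψ) : Set (Sym2 (V × V))).ncard := by
          refine Set.ncard_le_ncard ?_ (Set.toFinite _)
          rintro _ ⟨_, ⟨a, b, hab, rfl⟩, rfl⟩
          rw [Finset.mem_coe, Finset.mem_union, Finset.mem_image, Finset.mem_image]
          rcases hab.isBadPath_or_isBadOpposite hord with
            ⟨i, j, k, hik, hj, he⟩ | ⟨i, j, k, l, hs, hc, he⟩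
          · exact Or.inl ⟨⟨(i, k), j⟩, by simp [S, hik, hj], he.symm⟩
          · exact Or.inr ⟨⟨(i, k), (j, l)⟩, Finset.mem_filter.2 ⟨hs, hc⟩, he.symm⟩
      _ ≤ #S + #T := by
          rw [Set.ncard_coe_finset]
          exact (Finset.card_union_le _ _).trans
            (add_le_add Finset.card_image_le Finset.card_image_le)
  have h1 : 4 * #T ≤ #(squares G) := four_mul_card_closingArcMinimal_le hord
  have h2 : 4 * (#S : ℤ) + #(squares G) ≤ energy G := card_add_card_squares_le_energy hord
  omega

end BadPairs

open Filter in
theorem stmt7 {V : Type*} [Fintype V] (G : SimpleGraph V)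
    (elt : Sym2 V → Sym2 V → Prop) (hord : IsStrictTotalOrder (Sym2 V) elt) :
    (n1 G elt : ℤ) ≤ 2 * cyc G * (cyc G + 2) ∧ 0 ≤ gammaTwo G elt := by
  have h1 := four_mul_n1_le_energy (G := G) hord
  have h2 := (cyc_nonneg_and_energy_le G).2
  have h3 : (n1 G elt : ℤ) ≤ 2 * cyc G * (cyc G + 2) := by linarith
  exact ⟨h3, sub_nonneg.2 h3⟩

end SEP
end
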